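/- Let C = {v, w} be a mild contour from x to y in a ray category P such that v⃗ is transit, with v = v_1⋯v_n, w = w_1⋯w_m, α = v⃗_1, β = w⃗_1, γ = v⃗_2⋯v⃗_n, and ρ = π(y) = αω where ω is not an identity. If ωβ = γη for some non-identity morphism η, then either γ = ωξ for some morphism ξ or ωα = γφ for some morphism φ. -/

import Mathlib

set_option autoImplicit false

/-- A ray category (Bautista–Gabriel–Roiter–Salmerón).  The fields `pipow x`
record the powers of the generator `π(x)` of the radical of `P(x,x)`. -/
structure RayCategory : Type 1 where
  Obj : Type
  Hom : Obj → Obj → Type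
  id : ∀ x : Obj, Hom x x
  comp : ∀ {x y z : Obj}, Hom y z → Hom x y → Hom x z
  zero : ∀ x y : Obj, Hom x y
  comp_id : ∀ {x y : Obj} (f : Hom x y), comp f (id x) = f
  id_comp : ∀ {x y : Obj} (f : Hom x y), comp (id y) f = f
  assoc : ∀ {x y z w : Obj} (h : Hom z w) (g : Hom y z) (f : Hom x y),
      comp (comp h g) f = comp h (comp g f)
  /-- axiom b : zero morphisms -/
  zero_comp : ∀ {x y z : Obj} (f : Hom x y), comp (zero y z) f = zero x z
  comp_zero : ∀ {x y z : Obj} (f : Hom y z), comp f (zero x y) = zero x z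
  /-- axiom a : the objects are pairwise non-isomorphic -/
  no_iso : ∀ {x y : Obj} (f : Hom x y) (g : Hom y x),
      comp g f = id x → comp f g = id y → x = y
  /-- axiom c : local finiteness -/
  finite_target : ∀ x : Obj, {y : Obj | ∃ f : Hom x y, f ≠ zero x y}.Finite
  finite_source : ∀ x : Obj, {y : Obj | ∃ f : Hom y x, f ≠ zero y x}.Finite
  /-- the powers of the generator `π(x)` of `P(x,x)`; `pipow x 1 = π(x)`. -/
  pipow : ∀ x : Obj, ℕ → Hom x x
  pipow_zero : ∀ x, pipow x 0 = id x
  pipow_succ : ∀ x n, pipow x (n + 1) = comp (pipow x 1) (pipow x n)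
  nilp : Obj → ℕ
  nilp_pos : ∀ x, 1 ≤ nilp x
  /-- axiom d : `P(x,x) = {id, σ, …, σ^{n-1} ≠ 0 = σ^n}` -/
  endo_cyclic : ∀ (x : Obj) (f : Hom x x), ∃ i : ℕ, f = pipow x i
  pipow_nilp : ∀ x, pipow x (nilp x) = zero x x
  pipow_nilp_ne : ∀ x, pipow x (nilp x - 1) ≠ zero x x
  /-- axiom e : `P(x,y)` is cyclic under the action of `P(x,x)` or of `P(y,y)` -/
  hom_cyclic : ∀ x y : Obj, ∃ g : Hom x y,
      (∀ f : Hom x y, ∃ i : ℕ, f = comp (pipow y i) g) ∨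
      (∀ f : Hom x y, ∃ i : ℕ, f = comp g (pipow x i))
  /-- axiom f : cancellation -/
  cancel : ∀ {x y z w : Obj} (kappa : Hom x y) (mu nu : Hom y z) (lam : Hom z w),
      comp lam (comp mu kappa) = comp lam (comp nu kappa) →
      comp lam (comp mu kappa) ≠ zero x w → mu = nu

namespace RayCategory

variable (P : RayCategory)

/-- the generator of the radical of `P(x,x)` -/
def pi (x : P.Obj) : P.Hom x x := P.pipow x 1

/-- powers of an endomorphism -/
def pow {x : P.Obj} (f : P.Hom x x) : ℕ → P.Hom x x
  | 0 => P.id x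
  | n + 1 => P.comp f (pow f n)

/-- `f` is an identity morphism -/
def IsId {x y : P.Obj} (f : P.Hom x y) : Prop := ∃ _ : x = y, HEq f (P.id x)

/-- irreducible morphisms (= arrows of the quiver of `P`): nonzero morphisms which are
not identities and cannot be written as a product of two non-identity morphisms -/
def IsIrreducible {x y : P.Obj} (f : P.Hom x y) : Prop :=
  f ≠ P.zero x y ∧ ¬ P.IsId f ∧
    ∀ (z : P.Obj) (g : P.Hom z y) (h : P.Hom x z), f = P.comp g h → P.IsId g ∨ P.IsId h

/-- irreducibility inside the full subcategory supported by `S` -/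
def IsIrreducibleOn (S : Set P.Obj) {x y : P.Obj} (f : P.Hom x y) : Prop :=
  f ≠ P.zero x y ∧ ¬ P.IsId f ∧
    ∀ z ∈ S, ∀ (g : P.Hom z y) (h : P.Hom x z), f = P.comp g h → P.IsId g ∨ P.IsId h

/-- the sub-bimodule `P(y,y) μ P(x,x)` of `P(x,y)` generated by `μ` -/
def Bimod {x y : P.Obj} (mu : P.Hom x y) : Set (P.Hom x y) :=
  {f | ∃ i j : ℕ, f = P.comp (P.pipow y i) (P.comp mu (P.pipow x j))}

/-- `μ` is transit : the sub-bimodule generated by `μ` is cyclic over `P(y,y)` -/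
def IsTransit {x y : P.Obj} (mu : P.Hom x y) : Prop :=
  mu ≠ P.zero x y ∧
    ∃ g ∈ P.Bimod mu, ∀ f ∈ P.Bimod mu, ∃ i : ℕ, f = P.comp (P.pipow y i) g

/-- `μ` is cotransit : the sub-bimodule generated by `μ` is cyclic over `P(x,x)` -/
def IsCotransit {x y : P.Obj} (mu : P.Hom x y) : Prop :=
  mu ≠ P.zero x y ∧
    ∃ g ∈ P.Bimod mu, ∀ f ∈ P.Bimod mu, ∃ j : ℕ, f = P.comp g (P.pipow x j)

/-- `μ` is deep : `π(y)μ = 0 = μπ(x)` -/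
def IsDeep {x y : P.Obj} (mu : P.Hom x y) : Prop :=
  mu ≠ P.zero x y ∧ P.comp (P.pi y) mu = P.zero x y ∧ P.comp mu (P.pi x) = P.zero x y

/-- transport of a morphism along equalities of objects -/
def castHom {a b c d : P.Obj} (h1 : a = c) (h2 : b = d) (f : P.Hom a b) : P.Hom c d :=
  cast (by rw [h1, h2]) f

/-- the composite `a_{i+j-1} ⋯ a_{i+1} a_i : x_i → x_{i+j}` of a chain of morphisms -/
def chain (x : ℕ → P.Obj) (a : ∀ i : ℕ, P.Hom (x i) (x (i + 1))) (i : ℕ) :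
    ∀ j : ℕ, P.Hom (x i) (x (i + j))
  | 0 => P.id (x i)
  | j + 1 => P.comp (a (i + j)) (chain x a i j)

end RayCategory

/-- Paths in the quiver `Q_P` of a ray category `P` (the arrow `f` of `cons f hf p`
is the *last* arrow of the path). -/
inductive RPath (P : RayCategory) : P.Obj → P.Obj → Type
  | nil (x : P.Obj) : RPath P x x
  | cons {x y z : P.Obj} (f : P.Hom y z) (hf : P.IsIrreducible f) (p : RPath P x y) :
      RPath P x z

namespace RPath

variable {P : RayCategory}

/-- the morphism `v⃗` of `P` obtained by composing the arrows of a path `v` -/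
def toHom : ∀ {x y : P.Obj}, RPath P x y → P.Hom x y
  | _, _, .nil x => P.id x
  | _, _, .cons f _ p => P.comp f p.toHom

def length : ∀ {x y : P.Obj}, RPath P x y → ℕ
  | _, _, .nil _ => 0
  | _, _, .cons _ _ p => p.length + 1

/-- the set of points visited by a path -/
def points : ∀ {x y : P.Obj}, RPath P x y → Set P.Obj
  | _, _, .nil x => {x}
  | _, _, @RPath.cons _ _ _ z _ _ p => insert z p.points

/-- concatenation of paths -/
def append : ∀ {x y z : P.Obj}, RPath P y z → RPath P x y → RPath P x z
  | _, _, _, .nil _, p => p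
  | _, _, _, .cons f hf q, p => .cons f hf (q.append p)

/-- the arrow `g` occurs in the path -/
def HasArrow : ∀ {x y : P.Obj}, RPath P x y → ∀ {a b : P.Obj}, P.Hom a b → Prop
  | _, _, .nil _, _, _, _ => False
  | _, _, .cons f _ p, _, _, g => HEq f g ∨ p.HasArrow g

/-- one step of the interlacing relation: `v = p v' q`, `w = p w' q` with
`v⃗' = w⃗' ≠ 0` and `p`, `q` not both identities -/
def InterlaceStep {x y : P.Obj} (v w : RPath P x y) : Prop :=
  ∃ (a b : P.Obj) (p : RPath P b y) (v' w' : RPath P a b) (q : RPath P x a),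
    v = p.append (v'.append q) ∧ w = p.append (w'.append q) ∧
    v'.toHom = w'.toHom ∧ v'.toHom ≠ P.zero a b ∧ ¬ (p.length = 0 ∧ q.length = 0)

/-- two paths are interlaced if they lie in the transitive closure of the relation above -/
def Interlaced {x y : P.Obj} (v w : RPath P x y) : Prop :=
  Relation.TransGen (fun v' w' : RPath P x y => InterlaceStep v' w') v w

end RPath

/-- a chain of arrows as a path -/
def pchain (P : RayCategory) (x : ℕ → P.Obj) (a : ∀ i : ℕ, P.Hom (x i) (x (i + 1)))
    (ha : ∀ i, P.IsIrreducible (a i)) (i : ℕ) : ∀ j : ℕ, RPath P (x i) (x (i + j))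
  | 0 => .nil (x i)
  | j + 1 => .cons (a (i + j)) (ha (i + j)) (pchain P x a ha i j)

/-- A contour `C = {v,w}` of `P` from `x` to `y` : a pair of different, non-interlaced
paths with `v⃗ = w⃗ ≠ 0`. -/
structure Contour (P : RayCategory) (x y : P.Obj) : Type where
  v : RPath P x y
  w : RPath P x y
  ne : v ≠ w
  hom_eq : v.toHom = w.toHom
  nz : v.toHom ≠ P.zero x y
  nint : ¬ RPath.Interlaced v w
/-- A module over the linearization `k(D/I)` of the quotient by the ideal generated by the
morphisms in `I` of the full subcategory of `P` supported by `D`: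
a `k`-linear functor defined on the morphisms between points of `D`, vanishing on `I`.
For `D = Set.univ` and `I = fun _ _ _ => False` this is exactly a `k(P)`-module. -/
structure RMod (P : RayCategory) (k : Type) [Field k] (D : Set P.Obj)
    (I : ∀ a b : P.Obj, P.Hom a b → Prop) where
  M : P.Obj → Type
  [acg : ∀ x, AddCommGroup (M x)]
  [mod : ∀ x, Module k (M x)]
  act : ∀ {x y : P.Obj}, P.Hom x y → (M x →ₗ[k] M y)
  act_id : ∀ x ∈ D, act (P.id x) = LinearMap.id
  act_comp : ∀ {x y z : P.Obj}, x ∈ D → y ∈ D → z ∈ D →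
      ∀ (g : P.Hom y z) (f : P.Hom x y), act (P.comp g f) = (act g).comp (act f)
  act_zero : ∀ {x y : P.Obj}, x ∈ D → y ∈ D → act (P.zero x y) = 0
  supp : ∀ x : P.Obj, x ∉ D → ∀ m : M x, m = 0
  killed : ∀ {a b : P.Obj} (f : P.Hom a b), I a b f → act f = 0

attribute [instance] RMod.acg RMod.mod

/-- morphisms of modules -/
structure RModHom {P : RayCategory} {k : Type} [Field k] {D : Set P.Obj}
    {I : ∀ a b : P.Obj, P.Hom a b → Prop} (M N : RMod P k D I) where
  app : ∀ x : P.Obj, M.M x →ₗ[k] N.M x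
  natural : ∀ {x y : P.Obj} (f : P.Hom x y), (N.act f).comp (app x) = (app y).comp (M.act f)

/-- isomorphism of modules -/
def RModIso {P : RayCategory} {k : Type} [Field k] {D : Set P.Obj}
    {I : ∀ a b : P.Obj, P.Hom a b → Prop} (M N : RMod P k D I) : Prop :=
  ∃ φ : RModHom M N, ∀ x, Function.Bijective (φ.app x)

namespace RMod

variable {P : RayCategory} {k : Type} [Field k] {D : Set P.Obj}
  {I : ∀ a b : P.Obj, P.Hom a b → Prop}

/-- finite-dimensional: the sum of the dimensions of all `M x` is finite -/
def FinDim (M : RMod P k D I) : Prop :=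
  (∀ x, FiniteDimensional k (M.M x)) ∧ {x : P.Obj | ∃ m : M.M x, m ≠ 0}.Finite

def Nonzero (M : RMod P k D I) : Prop := ∃ x, ∃ m : M.M x, m ≠ 0

/-- indecomposable: nonzero, and the only idempotent endomorphisms are `0` and `id` -/
def Indec (M : RMod P k D I) : Prop :=
  M.Nonzero ∧ ∀ e : RModHom M M, (∀ x, (e.app x).comp (e.app x) = e.app x) →
    (∀ x, e.app x = 0) ∨ (∀ x, e.app x = LinearMap.id)

end RMod

/-- the full subcategory supported by `D` of the quotient of `P` by the ideal generated
by `I` is (locally) representation-finite: for any field `k`, every point lies in the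
support of only finitely many isomorphism classes of finite-dimensional indecomposables -/
def RepFin (P : RayCategory) (D : Set P.Obj) (I : ∀ a b : P.Obj, P.Hom a b → Prop) : Prop :=
  ∀ (k : Type) [Field k], ∀ x : P.Obj,
    ∃ (ι : Type) (_ : Finite ι) (rep : ι → RMod P k D I),
      ∀ M : RMod P k D I, M.FinDim → M.Indec → (∃ m : M.M x, m ≠ 0) →
        ∃ i : ι, RModIso (rep i) M

/-- the trivial ideal -/
def RayCategory.noIdeal (P : RayCategory) : ∀ a b : P.Obj, P.Hom a b → Prop :=
  fun _ _ _ => False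

/-- `P` is locally representation-finite -/
def LocRepFin (P : RayCategory) : Prop := RepFin P Set.univ P.noIdeal

/-- the ideal of `P` generated by the morphism `μ` -/
def IdealOf (P : RayCategory) {a b : P.Obj} (mu : P.Hom a b) :
    ∀ s t : P.Obj, P.Hom s t → Prop :=
  fun s t f => ∃ (g : P.Hom b t) (h : P.Hom s a), f = P.comp g (P.comp mu h)

/-- an ideal of a ray category -/
structure RIdeal (P : RayCategory) where
  mem : ∀ a b : P.Obj, P.Hom a b → Prop
  zero_mem : ∀ a b : P.Obj, mem a b (P.zero a b)
  comp_mem_left : ∀ {a b c : P.Obj} (g : P.Hom b c) (f : P.Hom a b),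
      mem a b f → mem a c (P.comp g f)
  comp_mem_right : ∀ {a b c : P.Obj} (g : P.Hom b c) (f : P.Hom a b),
      mem b c g → mem a c (P.comp g f)

/-- `P` is minimal representation-infinite: not locally representation-finite, but every
proper quotient (quotient by an ideal containing a nonzero morphism) is locally
representation-finite -/
def MinRepInfinite (P : RayCategory) : Prop :=
  ¬ LocRepFin P ∧ ∀ J : RIdeal P,
    (∃ (a b : P.Obj) (f : P.Hom a b), f ≠ P.zero a b ∧ J.mem a b f) →
      RepFin P Set.univ J.mem

/-- support of the indecomposable projective module `P_x` over the quotient of `P` by `I` -/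
def ProjSupp (P : RayCategory) (I : ∀ a b : P.Obj, P.Hom a b → Prop) (x : P.Obj) :
    Set P.Obj :=
  {y : P.Obj | ∃ f : P.Hom x y, f ≠ P.zero x y ∧ ¬ I x y f}

/-- support of the indecomposable injective module `I_y` over the quotient of `P` by `I` -/
def InjSupp (P : RayCategory) (I : ∀ a b : P.Obj, P.Hom a b → Prop) (y : P.Obj) :
    Set P.Obj :=
  {z : P.Obj | ∃ f : P.Hom z y, f ≠ P.zero z y ∧ ¬ I z y f}

namespace Contour

variable {P : RayCategory} {x y : P.Obj} (C : Contour P x y)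

/-- points of the contour = points of the full subcategory `P(C)` -/
def points : Set P.Obj := C.v.points ∪ C.w.points

/-- the contour is non-deep -/
def NonDeep : Prop := ¬ P.IsDeep C.v.toHom

/-- the ideal generated by `π(y)v⃗`, so that `P' = P/π(y)v⃗` (transit case) -/
def It : ∀ a b : P.Obj, P.Hom a b → Prop := IdealOf P (P.comp (P.pi y) C.v.toHom)

/-- the ideal generated by `v⃗π(x)` (cotransit case) -/
def Ic : ∀ a b : P.Obj, P.Hom a b → Prop := IdealOf P (P.comp C.v.toHom (P.pi x))

/-- decisive subcategories of `P' = P/π(y)v⃗` for `C` (transit case) -/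
def DecisiveT (D : Set P.Obj) : Prop :=
  x ∈ D ∧ y ∈ D ∧ D ⊆ ProjSupp P C.It x ∪ InjSupp P C.It y

/-- decisive subcategories (cotransit case) -/
def DecisiveC (D : Set P.Obj) : Prop :=
  x ∈ D ∧ y ∈ D ∧ D ⊆ ProjSupp P C.Ic x ∪ InjSupp P C.Ic y

/-- mildness in the transit case: `C` is non-deep, `v⃗` is transit, and every decisive
full subcategory of `P/π(y)v⃗` with at most 4 points is representation-finite -/
def MildTransit : Prop :=
  C.NonDeep ∧ P.IsTransit C.v.toHom ∧
    ∀ D : Set P.Obj, C.DecisiveT D → D.Finite → D.ncard ≤ 4 → RepFin P D C.It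

/-- mildness in the cotransit case (dual) -/
def MildCotransit : Prop :=
  C.NonDeep ∧ P.IsCotransit C.v.toHom ∧
    ∀ D : Set P.Obj, C.DecisiveC D → D.Finite → D.ncard ≤ 4 → RepFin P D C.Ic

/-- a mild contour -/
def Mild : Prop := C.MildTransit ∨ C.MildCotransit

/-- equality of contours (with possibly different endpoints), as sets `{v,w}` -/
def Same {x' y' : P.Obj} (C' : Contour P x' y') : Prop :=
  ∃ (_ : x = x') (_ : y = y'),
    (HEq C.v C'.v ∧ HEq C.w C'.w) ∨ (HEq C.v C'.w ∧ HEq C.w C'.v)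

end Contour
/-- the full subcategory on `{x,y}` is a dumb-bell with loops `lam`, `rho`, arrow `mu`
and nilpotency indices `r`, `s` -/
def DumbBellData (P : RayCategory) (x y : P.Obj) (lam : P.Hom x x) (mu : P.Hom x y)
    (rho : P.Hom y y) (r s : ℕ) : Prop :=
  x ≠ y ∧
  P.IsIrreducibleOn {x, y} lam ∧ P.IsIrreducibleOn {x, y} mu ∧ P.IsIrreducibleOn {x, y} rho ∧
  (∀ a b : P.Obj, a ∈ ({x, y} : Set P.Obj) → b ∈ ({x, y} : Set P.Obj) →
      ∀ f : P.Hom a b, P.IsIrreducibleOn {x, y} f → HEq f lam ∨ HEq f mu ∨ HEq f rho) ∧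
  P.comp mu lam = P.comp rho mu ∧
  P.pow lam r = P.zero x x ∧ P.pow rho s = P.zero y y ∧
  P.pow lam (r - 1) ≠ P.zero x x ∧ P.pow rho (s - 1) ≠ P.zero y y ∧
  min r s = 3 ∧ max r s ≤ 5 ∧
  (∀ f : P.Hom x x, ∃ i : ℕ, f = P.pow lam i) ∧
  (∀ f : P.Hom y y, ∃ i : ℕ, f = P.pow rho i) ∧
  (∀ f : P.Hom x y, f = P.zero x y ∨ ∃ i : ℕ, f = P.comp mu (P.pow lam i)) ∧
  (∀ i : ℕ, i < min r s → P.comp mu (P.pow lam i) ≠ P.zero x y) ∧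
  (∀ f : P.Hom y x, f = P.zero y x)

/-- the full subcategory supported by `S` is a dumb-bell -/
def IsDumbBellOn (P : RayCategory) (S : Set P.Obj) : Prop :=
  ∃ (x y : P.Obj) (lam : P.Hom x x) (mu : P.Hom x y) (rho : P.Hom y y) (r s : ℕ),
    DumbBellData P x y lam mu rho r s ∧ S = {x, y}

/-- the full subcategory on the points `x 0, …, x (n-1)` is a penny-farthing with arrows
`a i` (`a i = α_{i+1} : x_i → x_{i+1}`, indices mod `n`) and loop `rho` at `x 0` -/
def PennyData (P : RayCategory) (n : ℕ) (x : ℕ → P.Obj)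
    (a : ∀ i : ℕ, P.Hom (x i) (x (i + 1))) (rho : P.Hom (x 0) (x 0)) : Prop :=
  1 ≤ n ∧
  (∀ i, x (i + n) = x i) ∧ (∀ i, HEq (a (i + n)) (a i)) ∧
  (∀ i j, i < n → j < n → x i = x j → i = j) ∧
  (∀ i, P.IsIrreducibleOn (Set.range x) (a i)) ∧
  P.IsIrreducibleOn (Set.range x) rho ∧
  (∀ b c : P.Obj, b ∈ Set.range x → c ∈ Set.range x → ∀ f : P.Hom b c,
      P.IsIrreducibleOn (Set.range x) f → HEq f rho ∨ ∃ i, i < n ∧ HEq f (a i)) ∧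
  -- relation α₁αₙ = 0
  P.chain x a (n - 1) 2 = P.zero (x (n - 1)) (x (n - 1 + 2)) ∧
  -- relation αₙ⋯α₁ = ρ²
  (∀ h : x (0 + n) = x 0, P.castHom rfl h (P.chain x a 0 n) = P.comp rho rho) ∧
  -- relations 0 = α_{e i}⋯α₁ ρ αₙ⋯α_{i+1} for a non-decreasing e : {1,…,n-1} → {1,…,n}
  ∃ e : ℕ → ℕ,
    (∀ i, 1 ≤ i → i ≤ n - 1 → 1 ≤ e i ∧ e i ≤ n) ∧
    (∀ i j, 1 ≤ i → i ≤ j → j ≤ n - 1 → e i ≤ e j) ∧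
    (∀ i, 1 ≤ i → i ≤ n - 1 → ∀ h : x (i + (n - i)) = x 0,
      P.comp (P.chain x a 0 (e i))
        (P.comp rho (P.castHom rfl h (P.chain x a i (n - i)))) =
      P.zero (x i) (x (0 + e i)))

/-- the full subcategory supported by `S` is a penny-farthing -/
def IsPennyFarthingOn (P : RayCategory) (S : Set P.Obj) : Prop :=
  ∃ (n : ℕ) (x : ℕ → P.Obj) (a : ∀ i : ℕ, P.Hom (x i) (x (i + 1))) (rho : P.Hom (x 0) (x 0)),
    PennyData P n x a rho ∧ S = Set.range x

/-- the full subcategory on `{x,z,t,y}` is a diamond with arrows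
`gam : x → z`, `lam : z → x`, `del : x → t`, `bet : t → y`, `alp : z → y`, `kap : y → z` -/
def DiamondData (P : RayCategory) (x z t y : P.Obj) (gam : P.Hom x z) (lam : P.Hom z x)
    (del : P.Hom x t) (bet : P.Hom t y) (alp : P.Hom z y) (kap : P.Hom y z) : Prop :=
  (x ≠ z ∧ x ≠ t ∧ x ≠ y ∧ z ≠ t ∧ z ≠ y ∧ t ≠ y) ∧
  P.IsIrreducibleOn {x, z, t, y} gam ∧ P.IsIrreducibleOn {x, z, t, y} lam ∧
  P.IsIrreducibleOn {x, z, t, y} del ∧ P.IsIrreducibleOn {x, z, t, y} bet ∧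
  P.IsIrreducibleOn {x, z, t, y} alp ∧ P.IsIrreducibleOn {x, z, t, y} kap ∧
  (∀ a b : P.Obj, a ∈ ({x, z, t, y} : Set P.Obj) → b ∈ ({x, z, t, y} : Set P.Obj) →
      ∀ f : P.Hom a b, P.IsIrreducibleOn {x, z, t, y} f →
        HEq f gam ∨ HEq f lam ∨ HEq f del ∨ HEq f bet ∨ HEq f alp ∨ HEq f kap) ∧
  P.comp alp gam = P.comp bet del ∧
  P.comp lam kap = P.zero y x ∧
  P.comp kap alp = P.comp gam lam

/-- the full subcategory supported by `S` is a diamond -/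
def IsDiamondOn (P : RayCategory) (S : Set P.Obj) : Prop :=
  ∃ (x z t y : P.Obj) (gam : P.Hom x z) (lam : P.Hom z x) (del : P.Hom x t)
    (bet : P.Hom t y) (alp : P.Hom z y) (kap : P.Hom y z),
    DiamondData P x z t y gam lam del bet alp kap ∧ S = {x, z, t, y}


namespace RMod

section Pushforward

open Matrix

variable {P : RayCategory} {V : Type} (o : V → P.Obj) (n : V → ℕ)

/-- The space at `z` of a representation given at the points `o p`. -/
abbrev Fiber (z : P.Obj) : Type := ∀ p : {p : V // o p = z}, Fin (n p.1) → ℚ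

variable {o}

lemma fiber_ext (ho : Function.Injective o) {q : V} {m m' : Fiber o n (o q)}
    (h : m ⟨q, rfl⟩ = m' ⟨q, rfl⟩) : m = m' := by
  refine funext fun ⟨q', hq'⟩ => ?_
  obtain rfl := ho hq'
  exact h

/-- Evaluation of the fibre at one of the chosen points. -/
noncomputable def fiberEquiv (ho : Function.Injective o) (p : V) :
    Fiber o n (o p) ≃ₗ[ℚ] (Fin (n p) → ℚ) :=
  LinearEquiv.ofBijective
    (LinearMap.proj (φ := fun q : {q : V // o q = o p} => Fin (n q.1) → ℚ) ⟨p, rfl⟩)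
    ⟨fun _ _ h => fiber_ext n ho h, fun v =>
      ⟨fun q => cast (by rw [ho q.2]) v, rfl⟩⟩

variable {n}
variable (R : ∀ p q : V, P.Hom (o p) (o q) → Matrix (Fin (n q)) (Fin (n p)) ℚ)

open Classical in
/-- The action of a morphism on the fibres. -/
noncomputable def fiberAct {z w : P.Obj} (f : P.Hom z w) : Fiber o n z →ₗ[ℚ] Fiber o n w :=
  LinearMap.pi fun q =>
    if h : ∃ p, o p = z then
      (R h.choose q.1 (P.castHom h.choose_spec.symm q.2.symm f)).mulVecLin.comp
        (LinearMap.proj (φ := fun q : {q : V // o q = z} => Fin (n q.1) → ℚ)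
          ⟨h.choose, h.choose_spec⟩)
    else 0

lemma fiberAct_apply (ho : Function.Injective o) {p q : V} (f : P.Hom (o p) (o q))
    (m : Fiber o n (o p)) : fiberAct R f m ⟨q, rfl⟩ = R p q f *ᵥ m ⟨p, rfl⟩ := by
  have key : ∀ (p' : V) (hp' : o p' = o p),
      R p' q (P.castHom hp'.symm rfl f) *ᵥ m ⟨p', hp'⟩ = R p q f *ᵥ m ⟨p, rfl⟩ := by
    intro p' hp'
    obtain rfl := ho hp'
    rfl
  have h : ∃ p', o p' = o p := ⟨p, rfl⟩
  simp only [fiberAct, LinearMap.pi_apply, dif_pos h]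
  exact key _ h.choose_spec

lemma fiberAct_eq_zero_of_not_mem {z w : P.Obj} (f : P.Hom z w) (h : ¬ ∃ p, o p = z) :
    fiberAct R f = 0 := by
  refine LinearMap.ext fun m => funext fun q => ?_
  simp only [fiberAct, LinearMap.pi_apply, dif_neg h]
  rfl

/-- The module over `k(D/(ν))`, `D` the range of `o`, given by matrices `R p q f`. -/
noncomputable def ofMatrices (ho : Function.Injective o)
    (hid : ∀ p, R p p (P.id (o p)) = 1)
    (hcomp : ∀ p q r (g : P.Hom (o q) (o r)) (f : P.Hom (o p) (o q)),
      R p r (P.comp g f) = R q r g * R p q f)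
    (hzero : ∀ p q, R p q (P.zero (o p) (o q)) = 0)
    {s t : V} (nu : P.Hom (o s) (o t)) (hnu : R s t nu = 0) :
    RMod P ℚ (Set.range o) (IdealOf P nu) where
  M := Fiber o n
  act := fiberAct R
  act_id := by
    rintro _ ⟨p, rfl⟩
    refine LinearMap.ext fun m => fiber_ext n ho ?_
    rw [fiberAct_apply R ho, hid, one_mulVec, LinearMap.id_apply]
  act_comp := by
    rintro _ _ _ ⟨p, rfl⟩ ⟨q, rfl⟩ ⟨r, rfl⟩ g f
    refine LinearMap.ext fun m => fiber_ext n ho ?_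
    rw [fiberAct_apply R ho, LinearMap.comp_apply, fiberAct_apply R ho, fiberAct_apply R ho,
      hcomp, mulVec_mulVec]
  act_zero := by
    rintro _ _ ⟨p, rfl⟩ ⟨q, rfl⟩
    refine LinearMap.ext fun m => fiber_ext n ho ?_
    rw [fiberAct_apply R ho, hzero, zero_mulVec]
    rfl
  supp := by
    intro z hz m
    exact funext fun p => absurd ⟨p.1, p.2⟩ hz
  killed := by
    rintro z w f ⟨g, h, rfl⟩
    by_cases hz : ∃ p, o p = z
    · obtain ⟨p, rfl⟩ := hz
      refine LinearMap.ext fun m => funext fun ⟨q, hq⟩ => ?_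
      subst hq
      rw [fiberAct_apply R ho, hcomp, hcomp, hnu, Matrix.zero_mul, Matrix.mul_zero, zero_mulVec]
      rfl
    · exact fiberAct_eq_zero_of_not_mem R _ hz

end Pushforward

end RMod

/-- Two modules isomorphic to a third one are isomorphic. -/
lemma RModIso.symm_trans {P : RayCategory} {k : Type} [Field k] {D : Set P.Obj}
    {I : ∀ a b : P.Obj, P.Hom a b → Prop} {L M N : RMod P k D I}
    (h : RModIso L M) (h' : RModIso L N) : RModIso M N := by
  obtain ⟨φ, hφ⟩ := h
  obtain ⟨ψ, hψ⟩ := h'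
  let e : ∀ x, L.M x ≃ₗ[k] M.M x := fun x => LinearEquiv.ofBijective (φ.app x) (hφ x)
  refine ⟨⟨fun x => (ψ.app x).comp (e x).symm.toLinearMap, ?_⟩, fun x => ?_⟩
  · intro x y f
    refine LinearMap.ext fun m => ?_
    obtain ⟨l, rfl⟩ := (e x).surjective m
    have h1 : M.act f (e x l) = e y (L.act f l) := LinearMap.congr_fun (φ.natural f) l
    have h2 : N.act f (ψ.app x l) = ψ.app y (L.act f l) := LinearMap.congr_fun (ψ.natural f) l
    simp [h1, h2]
  · exact (hψ x).comp (e x).symm.bijective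

/-- A one-parameter family of indecomposable representations, given by matrices, shows that
the full subcategory on the range of `o` is not representation-finite. -/
theorem not_repFin_of_matrices {P : RayCategory} {V : Type} [Finite V] {o : V → P.Obj}
    (ho : Function.Injective o) (n : V → ℕ)
    (R : ℚ → ∀ p q : V, P.Hom (o p) (o q) → Matrix (Fin (n q)) (Fin (n p)) ℚ)
    (hid : ∀ c p, R c p p (P.id (o p)) = 1)
    (hcomp : ∀ c p q r (g : P.Hom (o q) (o r)) (f : P.Hom (o p) (o q)),
      R c p r (P.comp g f) = R c q r g * R c p q f)
    (hzero : ∀ c p q, R c p q (P.zero (o p) (o q)) = 0)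
    {s t : V} (nu : P.Hom (o s) (o t)) (hnu : ∀ c, R c s t nu = 0)
    (hs : 0 < n s)
    (hhom : ∀ (c d : ℚ) (Φ : ∀ p, Matrix (Fin (n p)) (Fin (n p)) ℚ),
      (∀ p q f, R d p q f * Φ p = Φ q * R c p q f) →
      (c = d ∨ ∃ p j, ∀ i, Φ p i j = 0) ∧
      ((∀ p, Φ p * Φ p = Φ p) → (∀ p, Φ p = 0) ∨ ∀ p, Φ p = 1)) :
    ¬ RepFin P (Set.range o) (IdealOf P nu) := by
  intro hfin
  obtain ⟨M, ev, hact⟩ : ∃ (M : ℚ → RMod P ℚ (Set.range o) (IdealOf P nu))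
      (ev : ∀ c p, (M c).M (o p) ≃ₗ[ℚ] (Fin (n p) → ℚ)),
      ∀ c p q (f : P.Hom (o p) (o q)) m,
        ev c q ((M c).act f m) = (R c p q f).mulVec (ev c p m) :=
    ⟨fun c => RMod.ofMatrices (R c) ho (hid c) (hcomp c) (hzero c) nu (hnu c),
      fun c => RMod.fiberEquiv (o := o) n ho, fun c p q f m => RMod.fiberAct_apply (R c) ho f m⟩
  let mat : ∀ {c d : ℚ}, RModHom (M c) (M d) → ∀ p, Matrix (Fin (n p)) (Fin (n p)) ℚ :=
    fun {c d} φ p => LinearMap.toMatrix'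
      ((ev d p).toLinearMap.comp ((φ.app (o p)).comp (ev c p).symm.toLinearMap))
  have hmat : ∀ {c d : ℚ} (φ : RModHom (M c) (M d)) p (m : (M c).M (o p)),
      ev d p (φ.app (o p) m) = (mat φ p).mulVec (ev c p m) := by
    intro c d φ p m
    rw [LinearMap.toMatrix'_mulVec]
    simp
  have hmat_ext : ∀ c {p q} (A B : Matrix (Fin (n q)) (Fin (n p)) ℚ),
      (∀ m, A.mulVec (ev c p m) = B.mulVec (ev c p m)) → A = B := by
    intro c p q A B h
    refine Matrix.toLin'.injective (LinearMap.ext fun v => ?_)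
    obtain ⟨m, rfl⟩ := (ev c p).surjective v
    simpa using h m
  have hnat : ∀ {c d : ℚ} (φ : RModHom (M c) (M d)) p q (f : P.Hom (o p) (o q)),
      R d p q f * mat φ p = mat φ q * R c p q f := by
    intro c d φ p q f
    refine hmat_ext c _ _ fun m => ?_
    rw [← Matrix.mulVec_mulVec, ← Matrix.mulVec_mulVec, ← hmat, ← hact, ← hact, ← hmat]
    exact congrArg (ev d q) (LinearMap.congr_fun (φ.natural f) m)
  have hfd : ∀ c, (M c).FinDim := by
    intro c
    refine ⟨fun z => ?_, (Set.finite_range o).subset ?_⟩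
    · by_cases hz : ∃ p, o p = z
      · obtain ⟨p, rfl⟩ := hz
        exact Module.Finite.equiv (ev c p).symm
      · have : Subsingleton ((M c).M z) :=
          ⟨fun a b => by rw [(M c).supp z hz a, (M c).supp z hz b]⟩
        infer_instance
    · rintro z ⟨m, hm⟩
      by_contra hz
      exact hm ((M c).supp z hz m)
  have hne : ∀ c, ∃ m : (M c).M (o s), m ≠ 0 := by
    intro c
    refine ⟨(ev c s).symm (Pi.single ⟨0, hs⟩ 1), fun h => ?_⟩
    have h0 := (LinearEquiv.map_eq_zero_iff _).1 h
    simpa using congrFun h0 ⟨0, hs⟩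
  have hind : ∀ c, (M c).Indec := by
    refine fun c => ⟨⟨o s, hne c⟩, fun e he => ?_⟩
    have hi : ∀ p, mat e p * mat e p = mat e p := by
      intro p
      refine hmat_ext c _ _ fun m => ?_
      rw [← Matrix.mulVec_mulVec, ← hmat, ← hmat]
      exact congrArg (ev c p) (LinearMap.congr_fun (he (o p)) m)
    rcases (hhom c c (mat e) (hnat e)).2 hi with h | h
    · left
      intro z
      refine LinearMap.ext fun m => ?_
      by_cases hz : ∃ p, o p = z
      · obtain ⟨p, rfl⟩ := hz
        apply (ev c p).injective
        rw [hmat, h, Matrix.zero_mulVec]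
        exact (map_zero (ev c p)).symm
      · exact (M c).supp z hz _
    · right
      intro z
      refine LinearMap.ext fun m => ?_
      by_cases hz : ∃ p, o p = z
      · obtain ⟨p, rfl⟩ := hz
        apply (ev c p).injective
        rw [hmat, h, Matrix.one_mulVec]
        rfl
      · rw [(M c).supp z hz m, map_zero, map_zero]
  obtain ⟨ι, hι, rep, hrep⟩ := hfin ℚ (o s)
  choose i hi using fun c => hrep (M c) (hfd c) (hind c) (hne c)
  obtain ⟨c, d, hcd, hicd⟩ := Finite.exists_ne_map_eq_of_infinite i
  have hd := hi d
  rw [← hicd] at hd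
  obtain ⟨φ, hφ⟩ := (hi c).symm_trans hd
  rcases (hhom c d (mat φ) (hnat φ)).1 with h | ⟨p, j, h⟩
  · exact hcd h
  · have h1 : φ.app (o p) ((ev c p).symm (Pi.single j 1)) = 0 := by
      apply (ev d p).injective
      rw [hmat, LinearEquiv.apply_symm_apply, Matrix.mulVec_single_one, map_zero]
      exact funext h
    have h2 := (hφ (o p)).1 (h1.trans (map_zero _).symm)
    have h0 := (LinearEquiv.map_eq_zero_iff _).1 h2
    simpa using congrFun h0 j

namespace RayCategory

local notation:80 g:81 " ⊚ " f:80 => RayCategory.comp _ g f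

variable {P : RayCategory}

lemma reassoc {x y z w : P.Obj} {g : P.Hom y z} {f : P.Hom x y} {h : P.Hom x z}
    (e : g ⊚ f = h) (t : P.Hom w x) : g ⊚ f ⊚ t = h ⊚ t := by
  rw [← P.assoc, e]

lemma reassoc_comp {x y y' z w : P.Obj} {g : P.Hom y z} {f : P.Hom x y} {g' : P.Hom y' z}
    {f' : P.Hom x y'} (e : g ⊚ f = g' ⊚ f') (t : P.Hom w x) :
    g ⊚ f ⊚ t = g' ⊚ f' ⊚ t := by
  rw [← P.assoc, e, P.assoc]

lemma left_ne_zero {x y z : P.Obj} {g : P.Hom y z} {f : P.Hom x y}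
    (h : g ⊚ f ≠ P.zero x z) : g ≠ P.zero y z := by
  rintro rfl
  exact h (P.zero_comp f)

lemma right_ne_zero {x y z : P.Obj} {g : P.Hom y z} {f : P.Hom x y}
    (h : g ⊚ f ≠ P.zero x z) : f ≠ P.zero x y := by
  rintro rfl
  exact h (P.comp_zero g)

lemma cancel_left {x y z : P.Obj} {g : P.Hom y z} {f f' : P.Hom x y} (h : g ⊚ f = g ⊚ f')
    (h0 : g ⊚ f ≠ P.zero x z) : f = f' :=
  P.cancel (P.id x) f f' g (by rw [P.comp_id, P.comp_id, h]) (by rwa [P.comp_id])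

lemma cancel_right {x y z : P.Obj} {g g' : P.Hom y z} {f : P.Hom x y} (h : g ⊚ f = g' ⊚ f)
    (h0 : g ⊚ f ≠ P.zero x z) : g = g' :=
  P.cancel f g g' (P.id z) (by rw [P.id_comp, P.id_comp, h]) (by rwa [P.id_comp])

lemma pipow_add (x : P.Obj) (i j : ℕ) : P.pipow x (i + j) = P.pipow x i ⊚ P.pipow x j := by
  induction i with
  | zero => rw [Nat.zero_add, P.pipow_zero, P.id_comp]
  | succ i ih => rw [Nat.succ_add, P.pipow_succ, P.pipow_succ x i, ih, P.assoc]

lemma pipow_comp_pipow (x : P.Obj) (i j : ℕ) :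
    P.pipow x i ⊚ P.pipow x j = P.pipow x (i + j) :=
  (pipow_add x i j).symm

lemma pipow_comp_pipow_comp {x y : P.Obj} (i j : ℕ) (f : P.Hom x y) :
    P.pipow y i ⊚ P.pipow y j ⊚ f = P.pipow y (i + j) ⊚ f :=
  reassoc (pipow_comp_pipow y i j) f

lemma pipow_zero_comp {x y : P.Obj} (f : P.Hom x y) : P.pipow y 0 ⊚ f = f := by
  rw [P.pipow_zero, P.id_comp]

lemma comp_pipow_zero {x y : P.Obj} (f : P.Hom x y) : f ⊚ P.pipow x 0 = f := by
  rw [P.pipow_zero, P.comp_id]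

lemma pipow_eq_zero (x : P.Obj) {i : ℕ} (h : P.nilp x ≤ i) : P.pipow x i = P.zero x x := by
  obtain ⟨j, rfl⟩ := Nat.exists_eq_add_of_le h
  rw [pipow_add, P.pipow_nilp, P.zero_comp]

lemma id_ne_zero (x : P.Obj) : P.id x ≠ P.zero x x := by
  have h := P.pipow_nilp_ne x
  rw [← P.comp_id (P.pipow x _)] at h
  exact right_ne_zero h

/-- A nonzero morphism is not a proper multiple of itself. -/
lemma eq_zero_of_eq_pipow_comp {x y : P.Obj} {f : P.Hom x y} (hf : f ≠ P.zero x y) {i j : ℕ}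
    (h : P.pipow y i ⊚ f ⊚ P.pipow x j = f) : i = 0 ∧ j = 0 := by
  have key : ∀ k, P.pipow y (k * i) ⊚ f ⊚ P.pipow x (k * j) = f := by
    intro k
    induction k with
    | zero => rw [Nat.zero_mul, Nat.zero_mul, pipow_zero_comp, comp_pipow_zero]
    | succ k ih =>
      have h' := congrArg (fun g => g ⊚ P.pipow x (k * j)) h
      simp only [P.assoc] at h'
      rw [Nat.succ_mul, Nat.succ_mul, Nat.add_comm (k * j), pipow_add, pipow_add, P.assoc, h', ih]
  constructor
  · by_contra hi
    refine hf ?_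
    rw [← key (P.nilp y), pipow_eq_zero y (Nat.le_mul_of_pos_right _ (Nat.pos_of_ne_zero hi)),
      P.zero_comp]
  · by_contra hi
    refine hf ?_
    rw [← key (P.nilp x), pipow_eq_zero x (Nat.le_mul_of_pos_right _ (Nat.pos_of_ne_zero hi)),
      P.comp_zero, P.comp_zero]

lemma pipow_comp_inj {x y : P.Obj} {f : P.Hom x y} {i j : ℕ}
    (h : P.pipow y i ⊚ f = P.pipow y j ⊚ f) (h0 : P.pipow y i ⊚ f ≠ P.zero x y) : i = j := by
  wlog hij : i ≤ j generalizing i j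
  · exact (this h.symm (h ▸ h0) (Nat.le_of_not_le hij)).symm
  obtain ⟨k, rfl⟩ := Nat.exists_eq_add_of_le hij
  rw [pipow_add, P.assoc] at h
  have h1 := cancel_left h h0
  have := (eq_zero_of_eq_pipow_comp (right_ne_zero h0) (i := k) (j := 0)
    (by rw [comp_pipow_zero]; exact h1.symm)).1
  omega

lemma comp_pipow_inj {x y : P.Obj} {f : P.Hom x y} {i j : ℕ}
    (h : f ⊚ P.pipow x i = f ⊚ P.pipow x j) (h0 : f ⊚ P.pipow x i ≠ P.zero x y) : i = j := by
  wlog hij : i ≤ j generalizing i j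
  · exact (this h.symm (h ▸ h0) (Nat.le_of_not_le hij)).symm
  obtain ⟨k, rfl⟩ := Nat.exists_eq_add_of_le hij
  rw [Nat.add_comm, pipow_add, ← P.assoc] at h
  have h1 := cancel_right h h0
  have := (eq_zero_of_eq_pipow_comp (left_ne_zero h0) (i := 0) (j := k)
    (by rw [pipow_zero_comp]; exact h1.symm)).2
  omega

lemma pipow_inj {x : P.Obj} {i j : ℕ} (h : P.pipow x i = P.pipow x j)
    (h0 : P.pipow x i ≠ P.zero x x) : i = j :=
  pipow_comp_inj (f := P.id x) (by rw [h]) (by rwa [P.comp_id])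

lemma pipow_ne_id {x : P.Obj} {i : ℕ} (hi : i ≠ 0) : P.pipow x i ≠ P.id x := by
  intro h
  rw [← P.pipow_zero] at h
  exact hi (pipow_inj h (by rw [h, P.pipow_zero]; exact id_ne_zero x))

/-- The source and the target of a split monomorphism coincide. -/
lemma obj_eq_of_comp_eq_id {x y : P.Obj} {g : P.Hom y x} {f : P.Hom x y}
    (h : g ⊚ f = P.id x) : x = y := by
  obtain ⟨i, hi⟩ := P.endo_cyclic y (f ⊚ g)
  have h1 : (f ⊚ g) ⊚ f ⊚ g = f ⊚ g := by
    rw [P.assoc, reassoc h, P.id_comp]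
  have h2 : f ⊚ g ≠ P.zero y y := by
    intro h2
    refine id_ne_zero x ?_
    rw [← P.id_comp (P.id x), ← h, P.assoc, reassoc h2, P.zero_comp, P.comp_zero]
  rw [hi, pipow_comp_pipow] at h1
  have h3 := pipow_inj h1.symm (hi ▸ h2)
  obtain rfl : i = 0 := by omega
  exact P.no_iso f g h (by rw [hi, P.pipow_zero])

lemma IsId.obj_eq {x y : P.Obj} {f : P.Hom x y} (h : P.IsId f) : x = y := h.choose

lemma isId_id (x : P.Obj) : P.IsId (P.id x) := ⟨rfl, HEq.rfl⟩

lemma isId_iff {x : P.Obj} {f : P.Hom x x} : P.IsId f ↔ f = P.id x :=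
  ⟨fun ⟨_, h⟩ => eq_of_heq h, fun h => h ▸ isId_id x⟩


lemma comp_pipow_of_comp_pi {x y : P.Obj} {f : P.Hom x y} {k : ℕ}
    (h : f ⊚ P.pipow x 1 = P.pipow y k ⊚ f) (m : ℕ) :
    f ⊚ P.pipow x m = P.pipow y (k * m) ⊚ f := by
  induction m with
  | zero => rw [Nat.mul_zero, pipow_zero_comp, comp_pipow_zero]
  | succ m ih => rw [P.pipow_succ, reassoc_comp h, ih, pipow_comp_pipow_comp, Nat.mul_succ,
      Nat.add_comm]

lemma pipow_comp_of_pi_comp {x y : P.Obj} {f : P.Hom x y} {k : ℕ}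
    (h : P.pipow y 1 ⊚ f = f ⊚ P.pipow x k) (m : ℕ) :
    P.pipow y m ⊚ f = f ⊚ P.pipow x (k * m) := by
  induction m with
  | zero => rw [Nat.mul_zero, pipow_zero_comp, comp_pipow_zero]
  | succ m ih => rw [P.pipow_succ, P.assoc, ih, reassoc_comp h, pipow_comp_pipow, Nat.mul_succ,
      Nat.add_comm]

lemma eq_zero_of_isId_pipow {x : P.Obj} {i : ℕ} (h : P.IsId (P.pipow x i)) : i = 0 := by
  by_contra hi
  exact pipow_ne_id hi (isId_iff.1 h)

lemma IsIrreducible.generates {x y : P.Obj} {f : P.Hom x y} (hf : P.IsIrreducible f)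
    (hxy : x ≠ y) :
    (∀ g : P.Hom x y, ∃ i, g = P.pipow y i ⊚ f) ∨ (∀ g : P.Hom x y, ∃ i, g = f ⊚ P.pipow x i) := by
  obtain ⟨g, hg | hg⟩ := P.hom_cyclic x y
  · left
    obtain ⟨i, hi⟩ := hg f
    rcases hf.2.2 _ _ _ hi with h | h
    · obtain rfl := eq_zero_of_isId_pipow h
      rw [pipow_zero_comp] at hi
      rwa [hi]
    · exact absurd h.obj_eq hxy
  · right
    obtain ⟨i, hi⟩ := hg f
    rcases hf.2.2 _ _ _ hi with h | h
    · exact absurd h.obj_eq hxy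
    · obtain rfl := eq_zero_of_isId_pipow h
      rw [comp_pipow_zero] at hi
      rwa [hi]

/-- The morphisms attached to a contour `(αγ, βδ)` from `x` to `y` with `π(y) = αω`,
`π(x) = ηδ` and `ωβ = γη`, where neither `γ ∈ ωP` nor `ωα ∈ γP`. -/
structure LoopedContour {x y a b : P.Obj} (α : P.Hom a y) (β : P.Hom b y) (γ : P.Hom x a)
    (δ : P.Hom x b) (ω : P.Hom y a) (η : P.Hom b x) : Prop where
  irr_α : P.IsIrreducible α
  irr_β : P.IsIrreducible β
  comm : α ⊚ γ = β ⊚ δ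
  rho : P.pipow y 1 = α ⊚ ω
  lam : P.pipow x 1 = η ⊚ δ
  sq : ω ⊚ β = γ ⊚ η
  nz : P.pipow y 1 ⊚ α ⊚ γ ≠ P.zero x y
  not_γ : ∀ ξ : P.Hom x y, γ ≠ ω ⊚ ξ
  not_ωα : ∀ φ : P.Hom a x, ω ⊚ α ≠ γ ⊚ φ
  a_ne_b : a ≠ b

namespace LoopedContour

variable {x y a b : P.Obj} {α : P.Hom a y} {β : P.Hom b y} {γ : P.Hom x a}
  {δ : P.Hom x b} {ω : P.Hom y a} {η : P.Hom b x} (L : LoopedContour α β γ δ ω η)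

include L

lemma omega_comm : ω ⊚ α ⊚ γ = γ ⊚ P.pipow x 1 := by
  rw [L.comm, reassoc_comp L.sq, L.lam]

lemma mu_pi : α ⊚ γ ⊚ P.pipow x 1 = P.pipow y 1 ⊚ α ⊚ γ := by
  rw [← L.omega_comm, L.rho, P.assoc]

lemma mu_pipow (m : ℕ) : α ⊚ γ ⊚ P.pipow x m = P.pipow y m ⊚ α ⊚ γ := by
  have := comp_pipow_of_comp_pi (f := α ⊚ γ) (k := 1) (by rw [P.assoc, L.mu_pi]) m
  rwa [Nat.one_mul, P.assoc] at this

lemma mu_ne_zero : α ⊚ γ ≠ P.zero x y := right_ne_zero L.nz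

lemma mu_pi_ne_zero : α ⊚ γ ⊚ P.pipow x 1 ≠ P.zero x y := L.mu_pi ▸ L.nz

lemma rho_comp {z : P.Obj} (f : P.Hom z y) (i : ℕ) :
    P.pipow y (i + 1) ⊚ f = α ⊚ ω ⊚ P.pipow y i ⊚ f := by
  rw [P.pipow_succ, P.assoc, L.rho, P.assoc]

lemma rho_pow (i : ℕ) : P.pipow y (i + 1) = α ⊚ ω ⊚ P.pipow y i := by
  rw [P.pipow_succ, L.rho, P.assoc]

lemma a_ne_y : a ≠ y := by
  rintro rfl
  obtain ⟨i, hi⟩ := P.endo_cyclic _ α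
  obtain ⟨l, hl⟩ := P.endo_cyclic _ ω
  have h := L.rho
  rw [hi, hl, pipow_comp_pipow] at h
  have h1 := pipow_inj h (left_ne_zero L.nz)
  rcases Nat.eq_zero_or_pos l with h0 | h0
  · exact L.not_γ γ (by rw [hl, h0, pipow_zero_comp])
  · obtain rfl : i = 0 := by omega
    exact L.irr_α.2.1 (isId_iff.2 (by rw [hi, P.pipow_zero]))

lemma b_ne_y : b ≠ y := by
  rintro rfl
  obtain ⟨i, hi⟩ := P.endo_cyclic _ β
  cases i with
  | zero => exact L.irr_β.2.1 (isId_iff.2 (by rw [hi, P.pipow_zero]))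
  | succ i =>
    rw [L.rho_pow] at hi
    rcases L.irr_β.2.2 _ _ _ hi with h | h
    · exact L.a_ne_y h.obj_eq
    · exact L.a_ne_y h.obj_eq.symm

/-- `μ = αγ` is not in the radical of `P(y,y)` times anything. -/
lemma eq_zero_of_mu_eq {g : P.Hom x y} {i : ℕ} (h : α ⊚ γ = P.pipow y i ⊚ g) : i = 0 := by
  cases i with
  | zero => rfl
  | succ i =>
    rw [L.rho_comp] at h
    exact absurd (cancel_left h L.mu_ne_zero) (L.not_γ _)

lemma x_ne_y : x ≠ y := by
  rintro rfl
  obtain ⟨i, hi⟩ := P.endo_cyclic _ (α ⊚ γ)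
  obtain rfl := L.eq_zero_of_mu_eq (g := P.id x) (by rw [P.comp_id, hi])
  exact L.a_ne_y (obj_eq_of_comp_eq_id (by rw [hi, P.pipow_zero])).symm

lemma x_ne_a : x ≠ a := by
  rintro rfl
  obtain ⟨i, hi⟩ := P.endo_cyclic _ γ
  obtain ⟨l, hl⟩ := P.endo_cyclic _ (ω ⊚ α)
  rcases le_total i l with h | h
  · obtain ⟨k, rfl⟩ := Nat.exists_eq_add_of_le h
    exact L.not_ωα (P.pipow x k) (by rw [hl, hi, pipow_comp_pipow])
  · obtain ⟨k, rfl⟩ := Nat.exists_eq_add_of_le h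
    exact L.not_γ (α ⊚ P.pipow x k) (by rw [hi, ← pipow_comp_pipow, ← hl, P.assoc])

lemma x_ne_b : x ≠ b := by
  rintro rfl
  obtain ⟨i, hi⟩ := P.endo_cyclic _ δ
  obtain ⟨l, hl⟩ := P.endo_cyclic _ η
  have h := L.lam
  rw [hi, hl, pipow_comp_pipow] at h
  have h1 := pipow_inj h (right_ne_zero (right_ne_zero L.mu_pi_ne_zero))
  rcases Nat.eq_zero_or_pos l with h0 | h0
  · refine L.not_γ β ?_
    rw [L.sq, hl, h0, comp_pipow_zero]
  · obtain rfl : i = 0 := by omega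
    have h2 := L.comm
    rw [hi, comp_pipow_zero] at h2
    rcases L.irr_β.2.2 _ _ _ h2.symm with h | h
    · exact L.a_ne_y h.obj_eq
    · exact L.x_ne_a h.obj_eq

lemma mu_generates (f : P.Hom x y) : ∃ i, f = P.pipow y i ⊚ α ⊚ γ := by
  obtain ⟨g, hg | hg⟩ := P.hom_cyclic x y
  · obtain ⟨i, hi⟩ := hg (α ⊚ γ)
    obtain rfl := L.eq_zero_of_mu_eq hi
    rw [pipow_zero_comp] at hi
    rw [hi]
    exact hg f
  · obtain ⟨i, hi⟩ := hg (α ⊚ γ)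
    obtain ⟨m, hm⟩ := hg (P.pipow y 1 ⊚ g)
    have h1 : g ⊚ P.pipow x (m + i) = g ⊚ P.pipow x (i + 1) := by
      rw [pipow_add, pipow_add, ← reassoc_comp hm, ← hi, ← L.mu_pi, reassoc_comp hi]
    have h2 : g ⊚ P.pipow x (i + 1) ≠ P.zero x y := by
      rw [pipow_add, ← P.assoc, ← hi, P.assoc]
      exact L.mu_pi_ne_zero
    have h3 := comp_pipow_inj h1 (h1 ▸ h2)
    obtain rfl : m = 1 := by omega
    cases i with
    | zero =>
      rw [comp_pipow_zero] at hi
      obtain ⟨j, hj⟩ := hg f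
      exact ⟨j, by rw [← L.mu_pipow, hj, ← hi, P.assoc]⟩
    | succ i =>
      rw [P.pipow_succ, ← reassoc_comp hm] at hi
      exact absurd (L.eq_zero_of_mu_eq hi) one_ne_zero

end LoopedContour

lemma comp_ne_id {x y : P.Obj} (h : x ≠ y) (g : P.Hom y x) (f : P.Hom x y) :
    g ⊚ f ≠ P.id x :=
  fun e => h (obj_eq_of_comp_eq_id e)

lemma comp_eq_id_iff {x : P.Obj} {g f : P.Hom x x} :
    g ⊚ f = P.id x ↔ g = P.id x ∧ f = P.id x := by
  refine ⟨fun h => ?_, ?_⟩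
  · obtain ⟨i, rfl⟩ := P.endo_cyclic _ g
    obtain ⟨j, rfl⟩ := P.endo_cyclic _ f
    rw [pipow_comp_pipow, ← P.pipow_zero] at h
    have := pipow_inj h (h ▸ by rw [P.pipow_zero]; exact id_ne_zero x)
    obtain ⟨rfl, rfl⟩ : i = 0 ∧ j = 0 := by omega
    exact ⟨P.pipow_zero x, P.pipow_zero x⟩
  · rintro ⟨rfl, rfl⟩
    exact P.id_comp _

lemma comp_eq_pi_iff {x : P.Obj} (h0 : P.pipow x 1 ≠ P.zero x x) {g f : P.Hom x x} :
    g ⊚ f = P.pipow x 1 ↔ g = P.id x ∧ f = P.pipow x 1 ∨ g = P.pipow x 1 ∧ f = P.id x := by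
  refine ⟨fun h => ?_, ?_⟩
  · obtain ⟨i, rfl⟩ := P.endo_cyclic _ g
    obtain ⟨j, rfl⟩ := P.endo_cyclic _ f
    rw [pipow_comp_pipow] at h
    have := pipow_inj h (h ▸ h0)
    rw [← P.pipow_zero]
    obtain ⟨rfl, rfl⟩ | ⟨rfl, rfl⟩ : i = 0 ∧ j = 1 ∨ i = 1 ∧ j = 0 := by omega
    · exact .inl ⟨rfl, rfl⟩
    · exact .inr ⟨rfl, rfl⟩
  · rintro (⟨rfl, rfl⟩ | ⟨rfl, rfl⟩)
    · exact P.id_comp _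
    · exact P.comp_id _

lemma pipow_comp_eq_self {x y : P.Obj} {f : P.Hom x y} (hf : f ≠ P.zero x y) {i : ℕ}
    (h : P.pipow y i ⊚ f = f) : i = 0 :=
  (eq_zero_of_eq_pipow_comp hf (j := 0) (by rwa [comp_pipow_zero])).1

lemma comp_pipow_eq_self {x y : P.Obj} {f : P.Hom x y} (hf : f ≠ P.zero x y) {i : ℕ}
    (h : f ⊚ P.pipow x i = f) : i = 0 :=
  (eq_zero_of_eq_pipow_comp hf (i := 0) (by rwa [pipow_zero_comp])).2

/-- A left multiple of a morphism by an endomorphism is the morphism only trivially. -/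
lemma comp_eq_self_iff_left {x y : P.Obj} {f : P.Hom x y} (hf : f ≠ P.zero x y)
    {g : P.Hom y y} : g ⊚ f = f ↔ g = P.id y := by
  refine ⟨fun h => ?_, fun h => by rw [h, P.id_comp]⟩
  obtain ⟨i, rfl⟩ := P.endo_cyclic _ g
  rw [pipow_comp_eq_self hf h, P.pipow_zero]

lemma comp_eq_self_iff_right {x y : P.Obj} {f : P.Hom x y} (hf : f ≠ P.zero x y)
    {g : P.Hom x x} : f ⊚ g = f ↔ g = P.id x := by
  refine ⟨fun h => ?_, fun h => by rw [h, P.comp_id]⟩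
  obtain ⟨i, rfl⟩ := P.endo_cyclic _ g
  rw [comp_pipow_eq_self hf h, P.pipow_zero]

/-- The hypothesis that `P(a,y)` is not generated by `α` over `P(y,y)`, spelled out. -/
structure LongLoopLeft {y a : P.Obj} (α : P.Hom a y) (ω : P.Hom y a) (j : ℕ) : Prop where
  gen : ∀ f : P.Hom a y, ∃ i, f = α ⊚ P.pipow a i
  eq : ω ⊚ α = P.pipow a j
  two_le : 2 ≤ j

namespace LoopedContour

variable {x y a b : P.Obj} {α : P.Hom a y} {β : P.Hom b y} {γ : P.Hom x a}
  {δ : P.Hom x b} {ω : P.Hom y a} {η : P.Hom b x} (L : LoopedContour α β γ δ ω η)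

include L

lemma exists_longLoopLeft (h : ¬ ∀ f : P.Hom a y, ∃ i, f = P.pipow y i ⊚ α) :
    ∃ j, LongLoopLeft α ω j := by
  obtain ⟨j, hj⟩ := P.endo_cyclic _ (ω ⊚ α)
  have hg := (L.irr_α.generates L.a_ne_y).resolve_left h
  refine ⟨j, hg, hj, ?_⟩
  by_contra hj2
  obtain rfl | rfl : j = 0 ∨ j = 1 := by omega
  · exact comp_ne_id L.a_ne_y ω α (hj.trans (P.pipow_zero a))
  · refine h fun f => ?_
    obtain ⟨i, rfl⟩ := hg f
    have := comp_pipow_of_comp_pi (f := α) (k := 1) (by rw [← hj, L.rho, P.assoc]) i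
    exact ⟨i, by rw [this, Nat.one_mul]⟩

lemma rho_ne_zero : P.pipow y 1 ≠ P.zero y y := left_ne_zero L.nz

lemma γ_ne_zero : γ ≠ P.zero x a := right_ne_zero L.mu_ne_zero

lemma rho_α_ne_zero : P.pipow y 1 ⊚ α ≠ P.zero a y := by
  have := L.nz
  rw [← P.assoc] at this
  exact left_ne_zero this

lemma ω_ne_zero : ω ≠ P.zero y a := by
  have := L.rho_ne_zero
  rw [L.rho] at this
  exact right_ne_zero this

lemma γ_pi_ne_zero : γ ⊚ P.pipow x 1 ≠ P.zero x a := right_ne_zero L.mu_pi_ne_zero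

section Left

variable {j : ℕ} (hj : LongLoopLeft α ω j)

include hj

lemma α_pipow (i m : ℕ) : P.pipow y i ⊚ α ⊚ P.pipow a m = α ⊚ P.pipow a (j * i + m) := by
  have := pipow_comp_of_pi_comp (f := α) (k := j) (by rw [L.rho, P.assoc, hj.eq]) i
  rw [reassoc_comp this, pipow_comp_pipow]

lemma pipow_γ (i : ℕ) : γ ⊚ P.pipow x i = P.pipow a (j * i) ⊚ γ :=
  comp_pipow_of_comp_pi (by rw [← L.omega_comm, reassoc hj.eq]) i

lemma α_sigma_ne_zero : α ⊚ P.pipow a 1 ≠ P.zero a y := by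
  have h := L.rho_α_ne_zero
  have := L.α_pipow hj 1 0
  rw [comp_pipow_zero] at this
  have h2 := hj.two_le
  obtain ⟨k, rfl⟩ := Nat.exists_eq_add_of_le h2
  rw [this, show (2 + k) * 1 + 0 = 1 + (k + 1) by omega, pipow_add, ← P.assoc] at h
  exact left_ne_zero h

lemma sigma_ne_zero : P.pipow a 1 ≠ P.zero a a := right_ne_zero (L.α_sigma_ne_zero hj)

lemma pipow_j_γ_ne_zero : P.pipow a j ⊚ γ ≠ P.zero x a := by
  have := L.pipow_γ hj 1
  rw [Nat.mul_one] at this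
  exact this ▸ L.γ_pi_ne_zero

/-- Morphisms from `x` to `a` are multiples of `γ`. -/
lemma left_gen_xa (f : P.Hom x a) : ∃ i, f = P.pipow a i ⊚ γ := by
  obtain ⟨g, hg | hg⟩ := P.hom_cyclic x a
  · obtain ⟨i, hi⟩ := hg γ
    rcases Nat.eq_zero_or_pos i with rfl | hi0
    · rw [pipow_zero_comp] at hi
      rw [hi]
      exact hg f
    · exfalso
      rcases Nat.lt_or_ge i j with h | h
      · obtain ⟨l, hl⟩ := L.mu_generates (α ⊚ g)
        have e0 : P.pipow a i ⊚ g ⊚ P.pipow x 1 = γ ⊚ P.pipow x 1 := reassoc hi.symm _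
        have e1 : P.pipow a i ⊚ P.pipow a j ⊚ g = P.pipow a i ⊚ g ⊚ P.pipow x 1 := by
          rw [e0, pipow_comp_pipow_comp, Nat.add_comm, ← pipow_comp_pipow_comp,
            ← hi, ← hj.eq, P.assoc, L.omega_comm]
        have e2 := cancel_left e1 (by rw [e1, e0]; exact L.γ_pi_ne_zero)
        have e3 : P.pipow a i ⊚ (g ⊚ P.pipow x 1) ⊚ P.pipow x l = g ⊚ P.pipow x 1 := by
          rw [P.assoc, reassoc hi.symm, ← e2, ← hj.eq, P.assoc, hl, ← L.mu_pipow,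
            ← P.assoc α, ← P.assoc ω, L.omega_comm, P.assoc]
        have := (eq_zero_of_eq_pipow_comp (right_ne_zero (e0 ▸ L.γ_pi_ne_zero)) e3).1
        omega
      · obtain ⟨k, rfl⟩ := Nat.exists_eq_add_of_le h
        rw [← pipow_comp_pipow_comp, ← hj.eq, P.assoc] at hi
        exact L.not_γ _ hi
  · obtain ⟨i, hi⟩ := hg γ
    obtain ⟨l, hl⟩ := L.mu_generates (α ⊚ g)
    have h1 : P.pipow y (l + i) ⊚ α ⊚ γ = α ⊚ γ := by
      rw [← pipow_comp_pipow_comp, ← L.mu_pipow, ← P.assoc α, ← P.assoc (P.pipow y l),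
        ← hl, P.assoc, ← hi]
    have h2 := pipow_comp_eq_self L.mu_ne_zero h1
    obtain rfl : i = 0 := by omega
    rw [comp_pipow_zero] at hi
    obtain ⟨m, hm⟩ := hg (P.pipow a 1 ⊚ g)
    rw [← hi] at hm
    have h3 := pipow_comp_of_pi_comp hm j
    have h4 := L.pipow_γ hj 1
    rw [Nat.mul_one, h3] at h4
    have h5 := comp_pipow_inj h4 L.γ_pi_ne_zero
    have h6 := hj.two_le
    have h7 := Nat.eq_one_of_mul_eq_one_left h5.symm
    omega

/-- Morphisms from `y` to `a` are multiples of `ω`. -/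
lemma left_gen_ya (f : P.Hom y a) : ∃ i m, f = P.pipow a i ⊚ ω ⊚ P.pipow y m := by
  obtain ⟨g, hg | hg⟩ := P.hom_cyclic y a
  · obtain ⟨i, hi⟩ := hg ω
    obtain ⟨l, hl⟩ := P.endo_cyclic _ (g ⊚ α)
    obtain ⟨m, hm⟩ := P.endo_cyclic _ (α ⊚ g)
    have h1 : P.pipow a (i + l) = P.pipow a j := by
      rw [← pipow_comp_pipow, ← hl, ← P.assoc, ← hi, hj.eq]
    have h0 : P.pipow a j ≠ P.zero a a := left_ne_zero (L.pipow_j_γ_ne_zero hj)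
    have h2 := pipow_inj h1.symm h0
    have h3 : α ⊚ P.pipow a l = α ⊚ P.pipow a (j * m) := by
      rw [← hl, ← P.assoc, hm, ← Nat.add_zero (j * m), ← L.α_pipow hj, comp_pipow_zero]
    have h4 : α ⊚ P.pipow a l ≠ P.zero a y := by
      refine left_ne_zero (g := α ⊚ P.pipow a l) (f := P.pipow a i) ?_
      have := L.α_pipow hj 1 0
      rw [P.assoc, pipow_comp_pipow, Nat.add_comm, ← h2]
      rw [Nat.mul_one, comp_pipow_zero] at this
      exact this ▸ L.rho_α_ne_zero
    have h5 := comp_pipow_inj h3 h4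
    have h6 : m ≠ 0 := by
      rintro rfl
      exact comp_ne_id L.a_ne_y.symm _ _ (hm.trans (P.pipow_zero y))
    obtain rfl : i = 0 := by
      obtain ⟨m, rfl⟩ := Nat.exists_eq_succ_of_ne_zero h6
      rw [Nat.mul_succ] at h5
      omega
    rw [pipow_zero_comp] at hi
    obtain ⟨k, hk⟩ := hg f
    exact ⟨k, 0, by rw [hk, hi, comp_pipow_zero]⟩
  · obtain ⟨i, hi⟩ := hg ω
    obtain ⟨m, hm⟩ := P.endo_cyclic _ (α ⊚ g)
    have h1 : P.pipow y 1 = P.pipow y (m + i) := by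
      rw [← pipow_comp_pipow, ← hm, P.assoc, ← hi, L.rho]
    have h2 := pipow_inj h1 L.rho_ne_zero
    have h6 : m ≠ 0 := by
      rintro rfl
      exact comp_ne_id L.a_ne_y.symm _ _ (hm.trans (P.pipow_zero y))
    obtain rfl : i = 0 := by omega
    rw [comp_pipow_zero] at hi
    obtain ⟨k, hk⟩ := hg f
    exact ⟨0, k, by rw [hk, hi, pipow_zero_comp]⟩

lemma left_xya (g : P.Hom y a) (f : P.Hom x y) : g ⊚ f ≠ γ := by
  intro h
  obtain ⟨i, m, rfl⟩ := L.left_gen_ya hj g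
  obtain ⟨l, rfl⟩ := L.mu_generates f
  rw [P.assoc, P.assoc, pipow_comp_pipow_comp, ← L.mu_pipow, ← P.assoc α, ← P.assoc ω,
    L.omega_comm, P.assoc, pipow_comp_pipow] at h
  have := (eq_zero_of_eq_pipow_comp L.γ_ne_zero h).2
  omega

/-- The exponent of `γφ` as a power of `π(a)` exceeds that of `ωα`. -/
lemma lt_of_γ_comp {φ : P.Hom a x} {n : ℕ} (h : γ ⊚ φ = P.pipow a n) : j < n := by
  by_contra hn
  obtain ⟨k, rfl⟩ := Nat.exists_eq_add_of_le (Nat.le_of_not_lt hn)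
  refine L.not_ωα (φ ⊚ P.pipow a k) ?_
  rw [hj.eq, ← P.assoc, h, pipow_comp_pipow]

lemma left_axa (g : P.Hom x a) (f : P.Hom a x) : g ⊚ f ≠ P.pipow a 1 := by
  intro h
  obtain ⟨l, rfl⟩ := L.left_gen_xa hj g
  obtain ⟨n, hn⟩ := P.endo_cyclic _ (γ ⊚ f)
  rw [P.assoc, hn, pipow_comp_pipow] at h
  have h1 := pipow_inj h.symm (L.sigma_ne_zero hj)
  have h2 := L.lt_of_γ_comp hj hn
  have h3 := hj.two_le
  omega

lemma left_aya (g : P.Hom y a) (f : P.Hom a y) : g ⊚ f ≠ P.pipow a 1 := by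
  intro h
  obtain ⟨i, m, rfl⟩ := L.left_gen_ya hj g
  obtain ⟨k, rfl⟩ := hj.gen f
  rw [P.assoc, P.assoc, L.α_pipow hj, reassoc hj.eq, pipow_comp_pipow, pipow_comp_pipow] at h
  have h1 := pipow_inj h.symm (L.sigma_ne_zero hj)
  have h3 := hj.two_le
  omega

lemma left_yxa (g : P.Hom x a) (f : P.Hom y x) : g ⊚ f ≠ ω := by
  intro h
  obtain ⟨l, rfl⟩ := L.left_gen_xa hj g
  obtain ⟨n, hn⟩ := P.endo_cyclic _ (γ ⊚ f ⊚ α)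
  have h0 : P.pipow a j ≠ P.zero a a := left_ne_zero (L.pipow_j_γ_ne_zero hj)
  have h1 : P.pipow a j = P.pipow a (l + n) := by
    rw [← hj.eq, ← h, ← pipow_comp_pipow, ← hn]
    simp only [P.assoc]
  have h2 := pipow_inj h1 h0
  have h3 := L.lt_of_γ_comp hj hn
  omega

lemma left_yaa {g : P.Hom a a} {f : P.Hom y a} : g ⊚ f = ω ↔ g = P.id a ∧ f = ω := by
  refine ⟨fun h => ?_, ?_⟩
  · obtain ⟨i, rfl⟩ := P.endo_cyclic _ g
    obtain ⟨k, m, rfl⟩ := L.left_gen_ya hj f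
    rw [pipow_comp_pipow_comp] at h
    have := eq_zero_of_eq_pipow_comp L.ω_ne_zero h
    obtain ⟨rfl, rfl, rfl⟩ : i = 0 ∧ k = 0 ∧ m = 0 := by omega
    exact ⟨P.pipow_zero a, by rw [pipow_zero_comp, comp_pipow_zero]⟩
  · rintro ⟨rfl, rfl⟩
    exact P.id_comp _

lemma left_yya {g : P.Hom y a} {f : P.Hom y y} : g ⊚ f = ω ↔ g = ω ∧ f = P.id y := by
  refine ⟨fun h => ?_, ?_⟩
  · obtain ⟨i, rfl⟩ := P.endo_cyclic _ f
    obtain ⟨k, m, rfl⟩ := L.left_gen_ya hj g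
    rw [P.assoc, P.assoc, pipow_comp_pipow] at h
    have := eq_zero_of_eq_pipow_comp L.ω_ne_zero h
    obtain ⟨rfl, rfl, rfl⟩ : i = 0 ∧ k = 0 ∧ m = 0 := by omega
    exact ⟨by rw [pipow_zero_comp, comp_pipow_zero], P.pipow_zero y⟩
  · rintro ⟨rfl, rfl⟩
    exact P.comp_id _

lemma left_xaa {g : P.Hom a a} {f : P.Hom x a} : g ⊚ f = γ ↔ g = P.id a ∧ f = γ := by
  refine ⟨fun h => ?_, ?_⟩
  · obtain ⟨i, rfl⟩ := P.endo_cyclic _ g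
    obtain ⟨k, rfl⟩ := L.left_gen_xa hj f
    rw [pipow_comp_pipow_comp] at h
    have := pipow_comp_eq_self L.γ_ne_zero h
    obtain ⟨rfl, rfl⟩ : i = 0 ∧ k = 0 := by omega
    exact ⟨P.pipow_zero a, pipow_zero_comp γ⟩
  · rintro ⟨rfl, rfl⟩
    exact P.id_comp _

lemma left_xxa {g : P.Hom x a} {f : P.Hom x x} : g ⊚ f = γ ↔ g = γ ∧ f = P.id x := by
  refine ⟨fun h => ?_, ?_⟩
  · obtain ⟨i, rfl⟩ := P.endo_cyclic _ f
    obtain ⟨k, rfl⟩ := L.left_gen_xa hj g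
    rw [P.assoc] at h
    have := eq_zero_of_eq_pipow_comp L.γ_ne_zero h
    obtain ⟨rfl, rfl⟩ : k = 0 ∧ i = 0 := by omega
    exact ⟨pipow_zero_comp γ, P.pipow_zero x⟩
  · rintro ⟨rfl, rfl⟩
    exact P.comp_id _

omit hj in
lemma xyy {g : P.Hom y y} {f : P.Hom x y} :
    g ⊚ f = α ⊚ γ ↔ g = P.id y ∧ f = α ⊚ γ := by
  refine ⟨fun h => ?_, ?_⟩
  · obtain ⟨i, rfl⟩ := P.endo_cyclic _ g
    obtain ⟨k, rfl⟩ := L.mu_generates f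
    rw [pipow_comp_pipow_comp] at h
    have := pipow_comp_eq_self L.mu_ne_zero h
    obtain ⟨rfl, rfl⟩ : i = 0 ∧ k = 0 := by omega
    exact ⟨P.pipow_zero y, pipow_zero_comp _⟩
  · rintro ⟨rfl, rfl⟩
    exact P.id_comp _

omit hj in
lemma xxy {g : P.Hom x y} {f : P.Hom x x} :
    g ⊚ f = α ⊚ γ ↔ g = α ⊚ γ ∧ f = P.id x := by
  refine ⟨fun h => ?_, ?_⟩
  · obtain ⟨i, rfl⟩ := P.endo_cyclic _ f
    obtain ⟨k, rfl⟩ := L.mu_generates g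
    rw [P.assoc] at h
    have := eq_zero_of_eq_pipow_comp L.mu_ne_zero h
    obtain ⟨rfl, rfl⟩ : k = 0 ∧ i = 0 := by omega
    exact ⟨pipow_zero_comp _, P.pipow_zero x⟩
  · rintro ⟨rfl, rfl⟩
    exact P.comp_id _

lemma left_xay {g : P.Hom a y} {f : P.Hom x a} : g ⊚ f = α ⊚ γ ↔ g = α ∧ f = γ := by
  refine ⟨fun h => ?_, ?_⟩
  · obtain ⟨i, rfl⟩ := hj.gen g
    obtain ⟨k, rfl⟩ := L.left_gen_xa hj f
    have h0 : α ⊚ P.pipow a i ⊚ P.pipow a k ⊚ γ ≠ P.zero x y := by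
      rw [← P.assoc α, h]; exact L.mu_ne_zero
    rw [P.assoc] at h
    have h1 := cancel_left h h0
    rw [pipow_comp_pipow_comp] at h1
    have := pipow_comp_eq_self L.γ_ne_zero h1
    obtain ⟨rfl, rfl⟩ : i = 0 ∧ k = 0 := by omega
    exact ⟨comp_pipow_zero _, pipow_zero_comp _⟩
  · rintro ⟨rfl, rfl⟩
    rfl

omit hj in
lemma comp_ne_α {z : P.Obj} (hz : z ≠ a) (hy : z ≠ y) (g : P.Hom z y) (f : P.Hom a z) :
    g ⊚ f ≠ α := by
  intro h
  rcases L.irr_α.2.2 _ _ _ h.symm with h | h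
  · exact hy h.obj_eq
  · exact hz h.obj_eq.symm

omit hj in
lemma comp_ne_β {z : P.Obj} (hz : z ≠ b) (hy : z ≠ y) (g : P.Hom z y) (f : P.Hom b z) :
    g ⊚ f ≠ β := by
  intro h
  rcases L.irr_β.2.2 _ _ _ h.symm with h | h
  · exact hy h.obj_eq
  · exact hz h.obj_eq.symm

omit hj in
lemma α_ne_zero : α ≠ P.zero a y := L.irr_α.1

lemma left_aay {g : P.Hom a y} {f : P.Hom a a} : g ⊚ f = α ↔ g = α ∧ f = P.id a := by
  refine ⟨fun h => ?_, ?_⟩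
  · obtain ⟨i, rfl⟩ := hj.gen g
    obtain ⟨k, rfl⟩ := P.endo_cyclic _ f
    rw [P.assoc, pipow_comp_pipow] at h
    have := comp_pipow_eq_self L.α_ne_zero h
    obtain ⟨rfl, rfl⟩ : i = 0 ∧ k = 0 := by omega
    exact ⟨comp_pipow_zero _, P.pipow_zero a⟩
  · rintro ⟨rfl, rfl⟩
    exact P.comp_id _

lemma left_aay' {g : P.Hom a y} {f : P.Hom a a} : g ⊚ f = α ⊚ P.pipow a 1 ↔
    g = α ∧ f = P.pipow a 1 ∨ g = α ⊚ P.pipow a 1 ∧ f = P.id a := by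
  refine ⟨fun h => ?_, ?_⟩
  · obtain ⟨i, rfl⟩ := hj.gen g
    obtain ⟨k, rfl⟩ := P.endo_cyclic _ f
    rw [P.assoc, pipow_comp_pipow] at h
    have := comp_pipow_inj h.symm (L.α_sigma_ne_zero hj)
    obtain ⟨rfl, rfl⟩ | ⟨rfl, rfl⟩ : i = 0 ∧ k = 1 ∨ i = 1 ∧ k = 0 := by omega
    · exact .inl ⟨comp_pipow_zero _, rfl⟩
    · exact .inr ⟨rfl, P.pipow_zero a⟩
  · rintro (⟨rfl, rfl⟩ | ⟨rfl, rfl⟩)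
    · rfl
    · exact P.comp_id _

lemma left_ayy {g : P.Hom y y} {f : P.Hom a y} : g ⊚ f = α ↔ g = P.id y ∧ f = α := by
  refine ⟨fun h => ?_, ?_⟩
  · obtain ⟨i, rfl⟩ := P.endo_cyclic _ g
    obtain ⟨k, rfl⟩ := hj.gen f
    have := eq_zero_of_eq_pipow_comp L.α_ne_zero h
    obtain ⟨rfl, rfl⟩ : i = 0 ∧ k = 0 := by omega
    exact ⟨P.pipow_zero y, comp_pipow_zero _⟩
  · rintro ⟨rfl, rfl⟩
    exact P.id_comp _

lemma left_ayy' {g : P.Hom y y} {f : P.Hom a y} : g ⊚ f = α ⊚ P.pipow a 1 ↔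
    g = P.id y ∧ f = α ⊚ P.pipow a 1 := by
  refine ⟨fun h => ?_, ?_⟩
  · obtain ⟨i, rfl⟩ := P.endo_cyclic _ g
    obtain ⟨k, rfl⟩ := hj.gen f
    rw [L.α_pipow hj] at h
    have h1 := comp_pipow_inj h.symm (L.α_sigma_ne_zero hj)
    have h2 := hj.two_le
    obtain rfl : i = 0 := by
      cases i with
      | zero => rfl
      | succ i => rw [Nat.mul_succ] at h1; omega
    obtain rfl : k = 1 := by omega
    exact ⟨P.pipow_zero y, rfl⟩
  · rintro ⟨rfl, rfl⟩
    exact P.id_comp _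

lemma left_axy (g : P.Hom x y) (f : P.Hom a x) : g ⊚ f ≠ α ⊚ P.pipow a 1 := by
  intro h
  obtain ⟨m, rfl⟩ := L.mu_generates g
  obtain ⟨n, hn⟩ := P.endo_cyclic _ (γ ⊚ f)
  rw [P.assoc, P.assoc, hn, L.α_pipow hj] at h
  have h1 := comp_pipow_inj h.symm (L.α_sigma_ne_zero hj)
  have h2 := L.lt_of_γ_comp hj hn
  have := hj.two_le
  omega

lemma left_yay {g : P.Hom a y} {f : P.Hom y a} : g ⊚ f = P.pipow y 1 ↔ g = α ∧ f = ω := by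
  refine ⟨fun h => ?_, ?_⟩
  · obtain ⟨i, rfl⟩ := hj.gen g
    obtain ⟨k, m, rfl⟩ := L.left_gen_ya hj f
    obtain ⟨n, hn⟩ := P.endo_cyclic _ (α ⊚ P.pipow a i ⊚ P.pipow a k ⊚ ω)
    have h1 : P.pipow y 1 = P.pipow y (n + m) := by
      rw [← h, ← pipow_comp_pipow, ← hn]
      simp only [P.assoc]
    have h2 := pipow_inj h1 L.rho_ne_zero
    have h3 : n ≠ 0 := by
      rintro rfl
      exact comp_ne_id L.a_ne_y.symm _ _ (hn.trans (P.pipow_zero y))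
    obtain ⟨rfl, rfl⟩ : n = 1 ∧ m = 0 := by omega
    rw [L.rho, pipow_comp_pipow_comp] at hn
    have h4 := cancel_left hn (by rw [hn, ← L.rho]; exact L.rho_ne_zero)
    have h5 := pipow_comp_eq_self L.ω_ne_zero h4
    obtain ⟨rfl, rfl⟩ : i = 0 ∧ k = 0 := by omega
    exact ⟨comp_pipow_zero _, by rw [pipow_zero_comp, comp_pipow_zero]⟩
  · rintro ⟨rfl, rfl⟩
    exact L.rho.symm

omit hj in
lemma yxy (g : P.Hom x y) (f : P.Hom y x) : g ⊚ f ≠ P.pipow y 1 := by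
  intro h
  obtain ⟨m, rfl⟩ := L.mu_generates g
  obtain ⟨n, hn⟩ := P.endo_cyclic _ (α ⊚ γ ⊚ f)
  rw [P.assoc, P.assoc, hn, pipow_comp_pipow] at h
  have h1 := pipow_inj h.symm L.rho_ne_zero
  have h3 : n ≠ 0 := by
    rintro rfl
    exact comp_ne_id L.a_ne_y.symm _ _ (hn.trans (P.pipow_zero y))
  obtain ⟨rfl, rfl⟩ : n = 1 ∧ m = 0 := by omega
  rw [L.rho] at hn
  have h4 := cancel_left hn (by rw [hn, ← L.rho]; exact L.rho_ne_zero)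
  refine L.not_ωα (f ⊚ α) ?_
  rw [← h4, P.assoc]

end Left

end LoopedContour

/-- The index type of the points of a full subcategory with three points. -/
inductive ThreePoints
  | src
  | mid
  | tgt

instance : Finite ThreePoints :=
  Finite.of_injective (fun | .src => (0 : Fin 3) | .mid => 1 | .tgt => 2)
    (by intro p q; cases p <;> cases q <;> simp)

/-- The three given points. -/
abbrev threePoints (x z y : P.Obj) : ThreePoints → P.Obj
  | .src => x
  | .mid => z
  | .tgt => y

lemma threePoints_injective {x z y : P.Obj} (hxz : x ≠ z) (hxy : x ≠ y) (hzy : z ≠ y) :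
    Function.Injective (threePoints x z y) := by
  intro p q h
  cases p <;> cases q <;> simp_all [threePoints]

lemma range_threePoints (x z y : P.Obj) : Set.range (threePoints x z y) = {x, z, y} := by
  ext w
  constructor
  · rintro ⟨p, rfl⟩
    cases p <;> simp [threePoints]
  · rintro (rfl | rfl | rfl)
    exacts [⟨.src, rfl⟩, ⟨.mid, rfl⟩, ⟨.tgt, rfl⟩]

section LeftRep

variable {x a y : P.Obj} (α : P.Hom a y) (γ : P.Hom x a) (ω : P.Hom y a) (c : ℚ)

open Classical in
/-- The component at `(x, x)` of a family of representations. -/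
noncomputable def leftXX (f : P.Hom x x) : Matrix (Fin 1) (Fin 1) ℚ :=
  if f = P.id x then 1 else 0

open Classical in
/-- The component at `(x, a)` of a family of representations. -/
noncomputable def leftXA (f : P.Hom x a) : Matrix (Fin 3) (Fin 1) ℚ :=
  if f = γ then !![0; 1; 0] else 0

open Classical in
/-- The component at `(x, y)` of a family of representations. -/
noncomputable def leftXY (f : P.Hom x y) : Matrix (Fin 2) (Fin 1) ℚ :=
  if f = α ⊚ γ then !![0; 1] else 0

open Classical in
/-- The component at `(a, a)` of a family of representations. -/
noncomputable def leftAA (f : P.Hom a a) : Matrix (Fin 3) (Fin 3) ℚ :=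
  if f = P.id a then 1 else if f = P.pipow a 1 then !![0, 0, 0; 0, 0, 0; 1, 0, 0] else 0

open Classical in
/-- The component at `(a, y)` of a family of representations. -/
noncomputable def leftAY (f : P.Hom a y) : Matrix (Fin 2) (Fin 3) ℚ :=
  if f = α then !![0, 0, 0; 0, 1, c] else
    if f = α ⊚ P.pipow a 1 then !![0, 0, 0; c, 0, 0] else 0

open Classical in
/-- The component at `(y, a)` of a family of representations. -/
noncomputable def leftYA (f : P.Hom y a) : Matrix (Fin 3) (Fin 2) ℚ :=
  if f = ω then !![0, 0; 1, 0; 1, 0] else 0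

open Classical in
/-- The component at `(y, y)` of a family of representations. -/
noncomputable def leftYY (f : P.Hom y y) : Matrix (Fin 2) (Fin 2) ℚ :=
  if f = P.id y then 1 else if f = P.pipow y 1 then !![0, 0; 1 + c, 0] else 0

/-- The dimensions of the representations `leftRep`. -/
abbrev leftDim : ThreePoints → ℕ
  | .src => 1
  | .mid => 3
  | .tgt => 2

/-- A one-parameter family of representations of the full subcategory on `x`, `a`, `y`. -/
noncomputable def leftRep :
    ∀ p q : ThreePoints, P.Hom (threePoints x a y p) (threePoints x a y q) →
      Matrix (Fin (leftDim q)) (Fin (leftDim p)) ℚ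
  | .src, .src => leftXX
  | .src, .mid => leftXA γ
  | .src, .tgt => leftXY α γ
  | .mid, .src => fun _ => 0
  | .mid, .mid => leftAA
  | .mid, .tgt => leftAY α c
  | .tgt, .src => fun _ => 0
  | .tgt, .mid => leftYA ω
  | .tgt, .tgt => leftYY c

end LeftRep

lemma leftRep_hom_aux {c d : ℚ} {A : Matrix (Fin 1) (Fin 1) ℚ} {B : Matrix (Fin 3) (Fin 3) ℚ}
    {C : Matrix (Fin 2) (Fin 2) ℚ}
    (hγ : (!![0; 1; 0] : Matrix (Fin 3) (Fin 1) ℚ) * A = B * (!![0; 1; 0] : Matrix (Fin 3) (Fin 1) ℚ))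
    (hσ : (!![0, 0, 0; 0, 0, 0; 1, 0, 0] : Matrix (Fin 3) (Fin 3) ℚ) * B =
      B * (!![0, 0, 0; 0, 0, 0; 1, 0, 0] : Matrix (Fin 3) (Fin 3) ℚ))
    (hα : (!![0, 0, 0; 0, 1, d] : Matrix (Fin 2) (Fin 3) ℚ) * B = C * (!![0, 0, 0; 0, 1, c] : Matrix (Fin 2) (Fin 3) ℚ))
    (hω : (!![0, 0; 1, 0; 1, 0] : Matrix (Fin 3) (Fin 2) ℚ) * C = B * (!![0, 0; 1, 0; 1, 0] : Matrix (Fin 3) (Fin 2) ℚ)) :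
    (c = d ∨ A 0 0 = 0) ∧ (A * A = A → B * B = B → C * C = C →
      (A = 0 ∧ B = 0 ∧ C = 0) ∨ (A = 1 ∧ B = 1 ∧ C = 1)) := by
  simp only [← Matrix.ext_iff, Fin.forall_fin_succ, Matrix.mul_apply, Fin.sum_univ_succ] at *
  simp at *
  constructor
  · grind
  · intros
    have : A 0 0 = 0 ∨ A 0 0 = 1 := by grind
    rcases this with h | h
    · refine .inl ?_
      grind
    · refine .inr ?_
      grind

namespace LoopedContour

variable {x y a b : P.Obj} {α : P.Hom a y} {β : P.Hom b y} {γ : P.Hom x a}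
  {δ : P.Hom x b} {ω : P.Hom y a} {η : P.Hom b x} (L : LoopedContour α β γ δ ω η)

include L

set_option linter.unusedSimpArgs false in
lemma leftRep_comp {j : ℕ} (hj : LongLoopLeft α ω j) (c : ℚ) : 
    ∀ (p q r : ThreePoints) (g : P.Hom (threePoints x a y q) (threePoints x a y r))
      (f : P.Hom (threePoints x a y p) (threePoints x a y q)),
      leftRep α γ ω c p r (P.comp g f) = leftRep α γ ω c q r g * leftRep α γ ω c p q f := by
  classical
  have hσ0 := L.sigma_ne_zero hj
  have hσ : P.pipow a 1 ≠ P.id a := pipow_ne_id one_ne_zero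
  have hρ : P.pipow y 1 ≠ P.id y := pipow_ne_id one_ne_zero
  have hασ : α ⊚ P.pipow a 1 ≠ α := fun h => one_ne_zero (comp_pipow_eq_self L.α_ne_zero h)
  have H : (∀ (g f : P.Hom x x), leftXX (g ⊚ f) = leftXX g * leftXX f) ∧
    (∀ (g : P.Hom x a) (f : P.Hom x x), leftXA γ (g ⊚ f) = leftXA γ g * leftXX f) ∧
    (∀ (g : P.Hom x y) (f : P.Hom x x), leftXY α γ (g ⊚ f) = leftXY α γ g * leftXX f) ∧
    (∀ (g : P.Hom a x) (f : P.Hom x a), leftXX (g ⊚ f) = 0) ∧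
    (∀ (g : P.Hom a a) (f : P.Hom x a), leftXA γ (g ⊚ f) = leftAA g * leftXA γ f) ∧
    (∀ (g : P.Hom a y) (f : P.Hom x a), leftXY α γ (g ⊚ f) = leftAY α c g * leftXA γ f) ∧
    (∀ (g : P.Hom y x) (f : P.Hom x y), leftXX (g ⊚ f) = 0) ∧
    (∀ (g : P.Hom y a) (f : P.Hom x y), leftXA γ (g ⊚ f) = leftYA ω g * leftXY α γ f) ∧
    (∀ (g : P.Hom y y) (f : P.Hom x y), leftXY α γ (g ⊚ f) = leftYY c g * leftXY α γ f) ∧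
    (∀ (g : P.Hom x a) (f : P.Hom a x), leftAA (g ⊚ f) = 0) ∧
    (∀ (g : P.Hom x y) (f : P.Hom a x), leftAY α c (g ⊚ f) = 0) ∧
    (∀ (g : P.Hom a a) (f : P.Hom a a), leftAA (g ⊚ f) = leftAA g * leftAA f) ∧
    (∀ (g : P.Hom a y) (f : P.Hom a a), leftAY α c (g ⊚ f) = leftAY α c g * leftAA f) ∧
    (∀ (g : P.Hom y a) (f : P.Hom a y), leftAA (g ⊚ f) = leftYA ω g * leftAY α c f) ∧
    (∀ (g : P.Hom y y) (f : P.Hom a y), leftAY α c (g ⊚ f) = leftYY c g * leftAY α c f) ∧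
    (∀ (g : P.Hom x a) (f : P.Hom y x), leftYA ω (g ⊚ f) = 0) ∧
    (∀ (g : P.Hom x y) (f : P.Hom y x), leftYY c (g ⊚ f) = 0) ∧
    (∀ (g : P.Hom a a) (f : P.Hom y a), leftYA ω (g ⊚ f) = leftAA g * leftYA ω f) ∧
    (∀ (g : P.Hom a y) (f : P.Hom y a), leftYY c (g ⊚ f) = leftAY α c g * leftYA ω f) ∧
    (∀ (g : P.Hom y a) (f : P.Hom y y), leftYA ω (g ⊚ f) = leftYA ω g * leftYY c f) ∧
    (∀ (g : P.Hom y y) (f : P.Hom y y), leftYY c (g ⊚ f) = leftYY c g * leftYY c f) := by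
    refine ⟨?_, ?_, ?_, ?_, ?_, ?_, ?_, ?_, ?_, ?_, ?_, ?_, ?_, ?_, ?_, ?_, ?_, ?_, ?_, ?_, ?_⟩
      <;> intro g f
      <;> simp only [leftXX, leftXA, leftXY, leftAA, leftAY, leftYA, leftYY,
        comp_eq_id_iff, comp_ne_id L.x_ne_y, comp_ne_id L.x_ne_a, comp_ne_id L.a_ne_y,
        comp_ne_id L.x_ne_y.symm, comp_ne_id L.x_ne_a.symm, comp_ne_id L.a_ne_y.symm,
        L.left_xya hj, L.left_axa hj, L.left_aya hj, L.left_yxa hj, L.left_yaa hj, L.left_yya hj,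
        L.left_xaa hj, L.left_xxa hj, L.xyy, L.xxy, L.left_xay hj,
        L.comp_ne_α L.x_ne_a L.x_ne_y, L.left_aay hj, L.left_aay' hj, L.left_ayy hj, L.left_ayy' hj,
        L.left_axy hj, L.left_yay hj, L.yxy, comp_eq_pi_iff hσ0, comp_eq_pi_iff L.rho_ne_zero,
        if_false]
      <;> split_ifs
      <;> try grind only
    all_goals
      first
      | simp only [Matrix.zero_mul, Matrix.mul_zero, Matrix.one_mul, Matrix.mul_one]
      | ext i k
        fin_cases i <;> fin_cases k <;> simp [Matrix.mul_apply, Fin.sum_univ_succ, add_comm]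
  obtain ⟨h1, h2, h3, h4, h5, h6, h7, h8, h9, h10, h11, h12, h13, h14, h15, h16, h17, h18, h19,
    h20, h21⟩ := H
  have zero_aux : ∀ {l m n : ℕ} {M : Matrix (Fin l) (Fin n) ℚ} {N : Matrix (Fin m) (Fin n) ℚ},
      M = 0 → M = (0 : Matrix (Fin l) (Fin m) ℚ) * N := fun h => by rw [h, Matrix.zero_mul]
  have aux_zero : ∀ {l m n : ℕ} {M : Matrix (Fin l) (Fin n) ℚ} {N : Matrix (Fin l) (Fin m) ℚ},
      M = 0 → M = N * (0 : Matrix (Fin m) (Fin n) ℚ) := fun h => by rw [h, Matrix.mul_zero]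
  rintro (_ | _ | _) (_ | _ | _) (_ | _ | _) g f
  exacts [h1 g f, h2 g f, h3 g f, zero_aux (h4 g f), h5 g f, h6 g f, zero_aux (h7 g f), h8 g f,
    h9 g f, aux_zero rfl, aux_zero (h10 g f), aux_zero (h11 g f), zero_aux rfl, h12 g f, h13 g f,
    zero_aux rfl, h14 g f, h15 g f, aux_zero rfl, aux_zero (h16 g f), aux_zero (h17 g f),
    zero_aux rfl, h18 g f, h19 g f, zero_aux rfl, h20 g f, h21 g f]

lemma leftRep_zero {j : ℕ} (hj : LongLoopLeft α ω j) (c : ℚ) (p q : ThreePoints) :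
    leftRep α γ ω c p q (P.zero _ _) = 0 := by
  cases p <;> cases q
  · exact if_neg (id_ne_zero x).symm
  · exact if_neg L.γ_ne_zero.symm
  · exact if_neg L.mu_ne_zero.symm
  · rfl
  · exact (if_neg (id_ne_zero a).symm).trans (if_neg (L.sigma_ne_zero hj).symm)
  · exact (if_neg L.α_ne_zero.symm).trans (if_neg (L.α_sigma_ne_zero hj).symm)
  · rfl
  · exact if_neg L.ω_ne_zero.symm
  · exact (if_neg (id_ne_zero y).symm).trans (if_neg L.rho_ne_zero.symm)

theorem not_repFin_left {j : ℕ} (hj : LongLoopLeft α ω j) :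
    ¬ RepFin P {x, a, y} (IdealOf P (P.pipow y 1 ⊚ α ⊚ γ)) := by
  rw [← range_threePoints]
  refine not_repFin_of_matrices (threePoints_injective L.x_ne_a L.x_ne_y L.a_ne_y) leftDim
    (leftRep α γ ω) ?_ (fun c p q r => L.leftRep_comp hj c p q r) (L.leftRep_zero hj)
    (s := .src) (t := .tgt) (P.pipow y 1 ⊚ α ⊚ γ) ?_ one_pos ?_
  · intro c p
    cases p <;> exact if_pos rfl
  · exact fun c => if_neg fun h => one_ne_zero (pipow_comp_eq_self L.mu_ne_zero h)
  · intro c d Φ hΦ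
    have hγ := hΦ .src .mid γ
    have hσ := hΦ .mid .mid (P.pipow a 1)
    have hα := hΦ .mid .tgt α
    have hω := hΦ .tgt .mid ω
    simp only [leftRep, leftXA, leftAA, leftAY, leftYA, if_true,
      if_neg (pipow_ne_id one_ne_zero : P.pipow a 1 ≠ P.id a)] at hγ hσ hα hω
    obtain ⟨h1, h2⟩ := leftRep_hom_aux hγ hσ hα hω
    refine ⟨h1.imp_right fun h => ⟨.src, 0, fun i => ?_⟩, fun h => ?_⟩
    · rwa [Subsingleton.elim i 0]
    · refine (h2 (h .src) (h .mid) (h .tgt)).imp ?_ ?_ <;>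
        rintro ⟨h3, h4, h5⟩ (_ | _ | _) <;> assumption

end LoopedContour

/-- The hypothesis that `P(b,y)` is not generated by `β` over `P(y,y)`, spelled out. -/
structure LongLoopRight {x y b : P.Obj} (β : P.Hom b y) (δ : P.Hom x b) (η : P.Hom b x)
    (l : ℕ) : Prop where
  gen : ∀ f : P.Hom b y, ∃ i, f = β ⊚ P.pipow b i
  eq : δ ⊚ η = P.pipow b l
  two_le : 2 ≤ l

namespace LoopedContour

variable {x y a b : P.Obj} {α : P.Hom a y} {β : P.Hom b y} {γ : P.Hom x a}
  {δ : P.Hom x b} {ω : P.Hom y a} {η : P.Hom b x} (L : LoopedContour α β γ δ ω η)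

include L

lemma rho_β : P.pipow y 1 ⊚ β = β ⊚ δ ⊚ η := by
  rw [L.rho, P.assoc, L.sq, reassoc_comp L.comm]

lemma exists_longLoopRight (h : ¬ ∀ f : P.Hom b y, ∃ i, f = P.pipow y i ⊚ β) :
    ∃ l, LongLoopRight β δ η l := by
  obtain ⟨l, hl⟩ := P.endo_cyclic _ (δ ⊚ η)
  have hg := (L.irr_β.generates L.b_ne_y).resolve_left h
  refine ⟨l, hg, hl, ?_⟩
  by_contra hl2
  obtain rfl | rfl : l = 0 ∨ l = 1 := by omega
  · exact comp_ne_id L.x_ne_b.symm δ η (hl.trans (P.pipow_zero b))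
  · refine h fun f => ?_
    obtain ⟨i, rfl⟩ := hg f
    have := comp_pipow_of_comp_pi (f := β) (k := 1) (by rw [← hl, L.rho_β]) i
    exact ⟨i, by rw [this, Nat.one_mul]⟩

lemma β_ne_zero : β ≠ P.zero b y := L.irr_β.1

lemma δ_pi_ne_zero : δ ⊚ P.pipow x 1 ≠ P.zero x b := by
  have := L.mu_pi_ne_zero
  rw [reassoc_comp L.comm] at this
  exact right_ne_zero this

lemma δ_ne_zero : δ ≠ P.zero x b := left_ne_zero L.δ_pi_ne_zero

lemma lam_ne_zero : P.pipow x 1 ≠ P.zero x x := right_ne_zero L.δ_pi_ne_zero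

lemma η_ne_zero : η ≠ P.zero b x := by
  have := L.lam_ne_zero
  rw [L.lam] at this
  exact left_ne_zero this

section Right

variable {l : ℕ} (hl : LongLoopRight β δ η l)

include hl

lemma β_pipow (i m : ℕ) : P.pipow y i ⊚ β ⊚ P.pipow b m = β ⊚ P.pipow b (l * i + m) := by
  have := pipow_comp_of_pi_comp (f := β) (k := l) (by rw [L.rho_β, hl.eq]) i
  rw [reassoc_comp this, pipow_comp_pipow]

lemma pipow_δ (i : ℕ) : δ ⊚ P.pipow x i = P.pipow b (l * i) ⊚ δ :=
  comp_pipow_of_comp_pi (by rw [L.lam, reassoc hl.eq]) i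

lemma pipow_l_δ_ne_zero : P.pipow b l ⊚ δ ≠ P.zero x b := by
  have := L.pipow_δ hl 1
  rw [Nat.mul_one] at this
  exact this ▸ L.δ_pi_ne_zero

lemma tau_δ_ne_zero : P.pipow b 1 ⊚ δ ≠ P.zero x b := by
  have h := L.pipow_l_δ_ne_zero hl
  obtain ⟨k, rfl⟩ := Nat.exists_eq_add_of_le hl.two_le
  rw [show 2 + k = (k + 1) + 1 by omega, pipow_add, P.assoc] at h
  exact right_ne_zero h

lemma tau_ne_zero : P.pipow b 1 ≠ P.zero b b := left_ne_zero (L.tau_δ_ne_zero hl)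

lemma pipow_l_ne_zero : P.pipow b l ≠ P.zero b b := left_ne_zero (L.pipow_l_δ_ne_zero hl)

lemma β_tau_ne_zero : β ⊚ P.pipow b 1 ≠ P.zero b y := by
  have h := L.mu_pi_ne_zero
  rw [reassoc_comp L.comm, L.pipow_δ hl, Nat.mul_one] at h
  obtain ⟨k, rfl⟩ := Nat.exists_eq_add_of_le hl.two_le
  rw [show 2 + k = 1 + (k + 1) by omega, pipow_add, P.assoc, ← P.assoc β] at h
  exact left_ne_zero h

lemma right_mul_ne_one (m : ℕ) : l * m ≠ 1 := fun h => by
  have := hl.two_le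
  have := Nat.eq_one_of_mul_eq_one_right h
  omega

/-- Morphisms from `x` to `b` are multiples of `δ`. -/
lemma right_gen_xb (f : P.Hom x b) : ∃ i, f = P.pipow b i ⊚ δ := by
  obtain ⟨g, hg | hg⟩ := P.hom_cyclic x b
  · obtain ⟨i, hi⟩ := hg δ
    rcases Nat.eq_zero_or_pos i with rfl | hi0
    · rw [pipow_zero_comp] at hi
      rw [hi]
      exact hg f
    · exfalso
      rcases Nat.lt_or_ge i l with h | h
      · obtain ⟨m, hm⟩ := P.endo_cyclic _ (η ⊚ g)
        have e0 : P.pipow b i ⊚ g ⊚ P.pipow x 1 = δ ⊚ P.pipow x 1 := reassoc hi.symm _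
        have e1 : P.pipow b i ⊚ P.pipow b l ⊚ g = P.pipow b i ⊚ g ⊚ P.pipow x 1 := by
          rw [e0, pipow_comp_pipow_comp, Nat.add_comm, ← pipow_comp_pipow_comp, ← hi,
            L.pipow_δ hl, Nat.mul_one]
        have e2 := cancel_left e1 (by rw [e1, e0]; exact L.δ_pi_ne_zero)
        have e3 : P.pipow b i ⊚ g ⊚ P.pipow x m = g ⊚ P.pipow x 1 := by
          rw [← e2, ← hl.eq, P.assoc, hm, reassoc hi.symm]
        cases m with
        | zero => exact comp_ne_id L.x_ne_b _ _ (hm.trans (P.pipow_zero x))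
        | succ m =>
          rw [Nat.add_comm, pipow_add, ← P.assoc g] at e3
          have := (eq_zero_of_eq_pipow_comp (right_ne_zero (e0 ▸ L.δ_pi_ne_zero)) e3).1
          omega
      · obtain ⟨k, rfl⟩ := Nat.exists_eq_add_of_le h
        rw [← pipow_comp_pipow_comp, ← hl.eq, P.assoc] at hi
        exact comp_ne_id L.x_ne_b _ _ ((comp_eq_self_iff_right L.δ_ne_zero).1 hi.symm)
  · obtain ⟨i, hi⟩ := hg δ
    obtain ⟨m, hm⟩ := L.mu_generates (β ⊚ g)
    have h1 : P.pipow y (m + i) ⊚ α ⊚ γ = α ⊚ γ := by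
      rw [← pipow_comp_pipow_comp, ← L.mu_pipow, ← P.assoc α, ← P.assoc (P.pipow y m),
        ← hm, P.assoc, ← hi, L.comm]
    have h2 := pipow_comp_eq_self L.mu_ne_zero h1
    obtain rfl : i = 0 := by omega
    rw [comp_pipow_zero] at hi
    obtain ⟨m, hm⟩ := hg (P.pipow b 1 ⊚ g)
    rw [← hi, L.pipow_δ hl] at hm
    exact absurd (pipow_comp_inj hm (L.tau_δ_ne_zero hl)).symm (L.right_mul_ne_one hl m)

/-- Morphisms from `b` to `x` are multiples of `η`. -/
lemma right_gen_bx (f : P.Hom b x) : ∃ m i, f = P.pipow x m ⊚ η ⊚ P.pipow b i := by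
  obtain ⟨g, hg | hg⟩ := P.hom_cyclic b x
  · obtain ⟨i, hi⟩ := hg η
    obtain ⟨s, hs⟩ := P.endo_cyclic _ (g ⊚ δ)
    have h1 : P.pipow x 1 = P.pipow x (i + s) := by
      rw [L.lam, hi, P.assoc, hs, pipow_comp_pipow]
    have h2 := pipow_inj h1 L.lam_ne_zero
    have h3 : s ≠ 0 := by
      rintro rfl
      exact comp_ne_id L.x_ne_b _ _ (hs.trans (P.pipow_zero x))
    obtain rfl : i = 0 := by omega
    rw [pipow_zero_comp] at hi
    obtain ⟨k, hk⟩ := hg f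
    exact ⟨k, 0, by rw [hk, hi, comp_pipow_zero]⟩
  · obtain ⟨i, hi⟩ := hg η
    obtain ⟨s, hs⟩ := P.endo_cyclic _ (δ ⊚ g)
    obtain ⟨n, hn⟩ := P.endo_cyclic _ (g ⊚ δ)
    have h1 : P.pipow b l = P.pipow b (s + i) := by
      rw [← hl.eq, hi, ← P.assoc, hs, pipow_comp_pipow]
    have h2 := pipow_inj h1 (L.pipow_l_ne_zero hl)
    have h3 : P.pipow b s ⊚ δ = P.pipow b (l * n) ⊚ δ := by
      rw [← hs, P.assoc, hn, L.pipow_δ hl]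
    have h4 : P.pipow b s ⊚ δ ≠ P.zero x b := by
      have := L.pipow_l_δ_ne_zero hl
      rw [h2, Nat.add_comm, pipow_add, P.assoc] at this
      exact right_ne_zero this
    have h5 := pipow_comp_inj h3 h4
    obtain rfl : i = 0 := by
      cases n with
      | zero => exact absurd (hn.trans (P.pipow_zero x)) (comp_ne_id L.x_ne_b _ _)
      | succ n => rw [Nat.mul_succ] at h5; omega
    rw [comp_pipow_zero] at hi
    obtain ⟨k, hk⟩ := hg f
    exact ⟨0, k, by rw [hk, hi, pipow_zero_comp]⟩

lemma right_δ_comp_ne {f : P.Hom b x} {n : ℕ} (h : δ ⊚ f = P.pipow b n) : n ≠ 0 := by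
  rintro rfl
  exact comp_ne_id L.x_ne_b.symm _ _ (h.trans (P.pipow_zero b))

lemma right_xbx {g : P.Hom b x} {f : P.Hom x b} : g ⊚ f = P.pipow x 1 ↔ g = η ∧ f = δ := by
  refine ⟨fun h => ?_, ?_⟩
  · obtain ⟨m, i, rfl⟩ := L.right_gen_bx hl g
    obtain ⟨n, rfl⟩ := L.right_gen_xb hl f
    obtain ⟨s, hs⟩ := P.endo_cyclic _ (η ⊚ P.pipow b (i + n) ⊚ δ)
    simp only [P.assoc, pipow_comp_pipow_comp] at h
    rw [hs, pipow_comp_pipow] at h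
    have h2 := pipow_inj h.symm L.lam_ne_zero
    have h3 : s ≠ 0 := by
      rintro rfl
      exact comp_ne_id L.x_ne_b _ _ (hs.trans (P.pipow_zero x))
    obtain ⟨rfl, rfl⟩ : s = 1 ∧ m = 0 := by omega
    rw [L.lam] at hs
    have h4 := cancel_left hs (by rw [hs, ← L.lam]; exact L.lam_ne_zero)
    have h5 := pipow_comp_eq_self L.δ_ne_zero h4
    obtain ⟨rfl, rfl⟩ : i = 0 ∧ n = 0 := by omega
    exact ⟨by rw [pipow_zero_comp, comp_pipow_zero], pipow_zero_comp _⟩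
  · rintro ⟨rfl, rfl⟩
    exact L.lam.symm

omit hl in
lemma xyx (g : P.Hom y x) (f : P.Hom x y) : g ⊚ f ≠ P.pipow x 1 := by
  intro h
  obtain ⟨m, rfl⟩ := L.mu_generates f
  obtain ⟨n, hn⟩ := P.endo_cyclic _ (α ⊚ γ ⊚ g)
  have h0 : P.pipow y (n + m) ⊚ α ⊚ γ = P.pipow y 1 ⊚ α ⊚ γ := by
    rw [← L.mu_pi, ← h, pipow_add, ← hn]
    simp only [P.assoc]
  have h1 := pipow_comp_inj h0 (h0 ▸ L.nz)
  have h3 : n ≠ 0 := by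
    rintro rfl
    exact comp_ne_id L.a_ne_y.symm _ _ (hn.trans (P.pipow_zero y))
  obtain ⟨rfl, rfl⟩ : n = 1 ∧ m = 0 := by omega
  exact L.yxy (α ⊚ γ) g (by rw [P.assoc, hn])

lemma right_xxb {g : P.Hom x b} {f : P.Hom x x} : g ⊚ f = δ ↔ g = δ ∧ f = P.id x := by
  refine ⟨fun h => ?_, ?_⟩
  · obtain ⟨i, rfl⟩ := P.endo_cyclic _ f
    obtain ⟨k, rfl⟩ := L.right_gen_xb hl g
    rw [P.assoc] at h
    have := eq_zero_of_eq_pipow_comp L.δ_ne_zero h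
    obtain ⟨rfl, rfl⟩ : k = 0 ∧ i = 0 := by omega
    exact ⟨pipow_zero_comp δ, P.pipow_zero x⟩
  · rintro ⟨rfl, rfl⟩
    exact P.comp_id _

lemma right_xxb' {g : P.Hom x b} {f : P.Hom x x} :
    g ⊚ f = P.pipow b 1 ⊚ δ ↔ g = P.pipow b 1 ⊚ δ ∧ f = P.id x := by
  refine ⟨fun h => ?_, ?_⟩
  · obtain ⟨i, rfl⟩ := P.endo_cyclic _ f
    obtain ⟨k, rfl⟩ := L.right_gen_xb hl g
    rw [P.assoc, L.pipow_δ hl, pipow_comp_pipow_comp] at h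
    have h1 := pipow_comp_inj h.symm (L.tau_δ_ne_zero hl)
    have h2 := hl.two_le
    obtain rfl : i = 0 := by
      cases i with
      | zero => rfl
      | succ i => rw [Nat.mul_succ] at h1; omega
    obtain rfl : k = 1 := by omega
    exact ⟨rfl, P.pipow_zero x⟩
  · rintro ⟨rfl, rfl⟩
    exact P.comp_id _

lemma right_xbb {g : P.Hom b b} {f : P.Hom x b} : g ⊚ f = δ ↔ g = P.id b ∧ f = δ := by
  refine ⟨fun h => ?_, ?_⟩
  · obtain ⟨i, rfl⟩ := P.endo_cyclic _ g
    obtain ⟨k, rfl⟩ := L.right_gen_xb hl f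
    rw [pipow_comp_pipow_comp] at h
    have := pipow_comp_eq_self L.δ_ne_zero h
    obtain ⟨rfl, rfl⟩ : i = 0 ∧ k = 0 := by omega
    exact ⟨P.pipow_zero b, pipow_zero_comp δ⟩
  · rintro ⟨rfl, rfl⟩
    exact P.id_comp _

lemma right_xbb' {g : P.Hom b b} {f : P.Hom x b} : g ⊚ f = P.pipow b 1 ⊚ δ ↔
    g = P.pipow b 1 ∧ f = δ ∨ g = P.id b ∧ f = P.pipow b 1 ⊚ δ := by
  refine ⟨fun h => ?_, ?_⟩
  · obtain ⟨i, rfl⟩ := P.endo_cyclic _ g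
    obtain ⟨k, rfl⟩ := L.right_gen_xb hl f
    rw [pipow_comp_pipow_comp] at h
    have := pipow_comp_inj h.symm (L.tau_δ_ne_zero hl)
    obtain ⟨rfl, rfl⟩ | ⟨rfl, rfl⟩ : i = 1 ∧ k = 0 ∨ i = 0 ∧ k = 1 := by omega
    · exact .inl ⟨rfl, pipow_zero_comp δ⟩
    · exact .inr ⟨P.pipow_zero b, rfl⟩
  · rintro (⟨rfl, rfl⟩ | ⟨rfl, rfl⟩)
    · rfl
    · exact P.id_comp _

lemma right_yb_β (g : P.Hom y b) : g ⊚ β ≠ P.pipow b 1 := by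
  intro h
  obtain ⟨m, hm⟩ := P.endo_cyclic _ (β ⊚ g)
  have h1 : β ⊚ P.pipow b 1 = β ⊚ P.pipow b (l * m) := by
    rw [← h, ← P.assoc, hm, ← Nat.add_zero (l * m), ← L.β_pipow hl, comp_pipow_zero]
  exact L.right_mul_ne_one hl m (comp_pipow_inj h1 (L.β_tau_ne_zero hl)).symm

lemma right_xyb (g : P.Hom y b) (f : P.Hom x y) : g ⊚ f ≠ δ := by
  intro h
  obtain ⟨m, rfl⟩ := L.mu_generates f
  rw [L.comm, ← P.assoc (P.pipow y m), ← P.assoc, comp_eq_self_iff_left L.δ_ne_zero,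
    ← P.assoc] at h
  exact comp_ne_id L.b_ne_y _ _ h

lemma right_xyb' (g : P.Hom y b) (f : P.Hom x y) : g ⊚ f ≠ P.pipow b 1 ⊚ δ := by
  intro h
  obtain ⟨m, rfl⟩ := L.mu_generates f
  rw [L.comm, ← P.assoc (P.pipow y m), ← P.assoc] at h
  have := cancel_right h (h ▸ L.tau_δ_ne_zero hl)
  exact L.right_yb_β hl (g ⊚ P.pipow y m) (by rw [P.assoc, this])

lemma right_xby {g : P.Hom b y} {f : P.Hom x b} : g ⊚ f = α ⊚ γ ↔ g = β ∧ f = δ := by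
  refine ⟨fun h => ?_, ?_⟩
  · obtain ⟨i, rfl⟩ := hl.gen g
    obtain ⟨k, rfl⟩ := L.right_gen_xb hl f
    rw [L.comm, P.assoc, pipow_comp_pipow_comp] at h
    have h0 : β ⊚ δ ≠ P.zero x y := L.comm ▸ L.mu_ne_zero
    have h1 := pipow_comp_eq_self L.δ_ne_zero (cancel_left h (h ▸ h0))
    obtain ⟨rfl, rfl⟩ : i = 0 ∧ k = 0 := by omega
    exact ⟨comp_pipow_zero _, pipow_zero_comp _⟩
  · rintro ⟨rfl, rfl⟩
    exact L.comm.symm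

lemma right_bxb (g : P.Hom x b) (f : P.Hom b x) : g ⊚ f ≠ P.pipow b 1 := by
  intro h
  obtain ⟨n, rfl⟩ := L.right_gen_xb hl g
  obtain ⟨s, hs⟩ := P.endo_cyclic _ (δ ⊚ f)
  rw [P.assoc, hs, pipow_comp_pipow] at h
  have h1 := pipow_inj h.symm (L.tau_ne_zero hl)
  have h2 := L.right_δ_comp_ne hl hs
  obtain ⟨rfl, rfl⟩ : s = 1 ∧ n = 0 := by omega
  obtain ⟨m, hm⟩ := P.endo_cyclic _ (f ⊚ δ)
  have h3 : P.pipow b 1 ⊚ δ = P.pipow b (l * m) ⊚ δ := by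
    rw [← hs, P.assoc, hm, L.pipow_δ hl]
  exact L.right_mul_ne_one hl m (pipow_comp_inj h3 (L.tau_δ_ne_zero hl)).symm

lemma right_byb (g : P.Hom y b) (f : P.Hom b y) : g ⊚ f ≠ P.pipow b 1 := by
  intro h
  obtain ⟨i, rfl⟩ := hl.gen f
  obtain ⟨s, hs⟩ := P.endo_cyclic _ (g ⊚ β)
  rw [reassoc hs, pipow_comp_pipow] at h
  have h1 := pipow_inj h.symm (L.tau_ne_zero hl)
  have h2 : s ≠ 0 := by
    rintro rfl
    exact comp_ne_id L.b_ne_y _ _ (hs.trans (P.pipow_zero b))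
  obtain ⟨rfl, rfl⟩ : s = 1 ∧ i = 0 := by omega
  exact L.right_yb_β hl g hs

lemma right_bxx {g : P.Hom x x} {f : P.Hom b x} : g ⊚ f = η ↔ g = P.id x ∧ f = η := by
  refine ⟨fun h => ?_, ?_⟩
  · obtain ⟨i, rfl⟩ := P.endo_cyclic _ g
    obtain ⟨k, m, rfl⟩ := L.right_gen_bx hl f
    rw [pipow_comp_pipow_comp] at h
    have := eq_zero_of_eq_pipow_comp L.η_ne_zero h
    obtain ⟨rfl, rfl, rfl⟩ : i = 0 ∧ k = 0 ∧ m = 0 := by omega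
    exact ⟨P.pipow_zero x, by rw [pipow_zero_comp, comp_pipow_zero]⟩
  · rintro ⟨rfl, rfl⟩
    exact P.id_comp _

lemma right_bbx {g : P.Hom b x} {f : P.Hom b b} : g ⊚ f = η ↔ g = η ∧ f = P.id b := by
  refine ⟨fun h => ?_, ?_⟩
  · obtain ⟨i, rfl⟩ := P.endo_cyclic _ f
    obtain ⟨k, m, rfl⟩ := L.right_gen_bx hl g
    rw [P.assoc, P.assoc, pipow_comp_pipow] at h
    have := eq_zero_of_eq_pipow_comp L.η_ne_zero h
    obtain ⟨rfl, rfl, rfl⟩ : i = 0 ∧ k = 0 ∧ m = 0 := by omega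
    exact ⟨by rw [pipow_zero_comp, comp_pipow_zero], P.pipow_zero b⟩
  · rintro ⟨rfl, rfl⟩
    exact P.comp_id _

omit hl in
lemma byx (g : P.Hom y x) (f : P.Hom b y) : g ⊚ f ≠ η := fun h =>
  L.xyx g (f ⊚ δ) (by rw [← P.assoc, h, L.lam])

lemma right_bby {g : P.Hom b y} {f : P.Hom b b} : g ⊚ f = β ↔ g = β ∧ f = P.id b := by
  refine ⟨fun h => ?_, ?_⟩
  · obtain ⟨i, rfl⟩ := hl.gen g
    obtain ⟨k, rfl⟩ := P.endo_cyclic _ f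
    rw [P.assoc, pipow_comp_pipow] at h
    have := comp_pipow_eq_self L.β_ne_zero h
    obtain ⟨rfl, rfl⟩ : i = 0 ∧ k = 0 := by omega
    exact ⟨comp_pipow_zero _, P.pipow_zero b⟩
  · rintro ⟨rfl, rfl⟩
    exact P.comp_id _

lemma right_byy {g : P.Hom y y} {f : P.Hom b y} : g ⊚ f = β ↔ g = P.id y ∧ f = β := by
  refine ⟨fun h => ?_, ?_⟩
  · obtain ⟨i, rfl⟩ := P.endo_cyclic _ g
    obtain ⟨k, rfl⟩ := hl.gen f
    have := eq_zero_of_eq_pipow_comp L.β_ne_zero h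
    obtain ⟨rfl, rfl⟩ : i = 0 ∧ k = 0 := by omega
    exact ⟨P.pipow_zero y, comp_pipow_zero _⟩
  · rintro ⟨rfl, rfl⟩
    exact P.id_comp _

end Right

end LoopedContour

section RightRep

variable {x b y : P.Obj} (β : P.Hom b y) (δ : P.Hom x b) (η : P.Hom b x) (c : ℚ)

open Classical in
/-- The component at `(x, x)` of a family of representations. -/
noncomputable def rightXX (f : P.Hom x x) : Matrix (Fin 2) (Fin 2) ℚ :=
  if f = P.id x then 1 else if f = P.pipow x 1 then !![0, 1 + c; 0, 0] else 0

open Classical in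
/-- The component at `(x, b)` of a family of representations. -/
noncomputable def rightXB (f : P.Hom x b) : Matrix (Fin 3) (Fin 2) ℚ :=
  if f = δ then !![0, 0; 0, 1; 0, c] else
    if f = P.pipow b 1 ⊚ δ then !![0, c; 0, 0; 0, 0] else 0

open Classical in
/-- The component at `(x, y)` of a family of representations. -/
noncomputable def rightXY (f : P.Hom x y) : Matrix (Fin 1) (Fin 2) ℚ :=
  if f = β ⊚ δ then !![0, 1] else 0

open Classical in
/-- The component at `(b, x)` of a family of representations. -/
noncomputable def rightBX (f : P.Hom b x) : Matrix (Fin 2) (Fin 3) ℚ :=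
  if f = η then !![0, 1, 1; 0, 0, 0] else 0

open Classical in
/-- The component at `(b, b)` of a family of representations. -/
noncomputable def rightBB (f : P.Hom b b) : Matrix (Fin 3) (Fin 3) ℚ :=
  if f = P.id b then 1 else if f = P.pipow b 1 then !![0, 0, 1; 0, 0, 0; 0, 0, 0] else 0

open Classical in
/-- The component at `(b, y)` of a family of representations. -/
noncomputable def rightBY (f : P.Hom b y) : Matrix (Fin 1) (Fin 3) ℚ :=
  if f = β then !![0, 1, 0] else 0

open Classical in
/-- The component at `(y, y)` of a family of representations. -/
noncomputable def rightYY (f : P.Hom y y) : Matrix (Fin 1) (Fin 1) ℚ :=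
  if f = P.id y then 1 else 0

/-- The dimensions of the representations `rightRep`. -/
abbrev rightDim : ThreePoints → ℕ
  | .src => 2
  | .mid => 3
  | .tgt => 1

/-- A one-parameter family of representations of the full subcategory on `x`, `b`, `y`. -/
noncomputable def rightRep :
    ∀ p q : ThreePoints, P.Hom (threePoints x b y p) (threePoints x b y q) →
      Matrix (Fin (rightDim q)) (Fin (rightDim p)) ℚ
  | .src, .src => rightXX c
  | .src, .mid => rightXB δ c
  | .src, .tgt => rightXY β δ
  | .mid, .src => rightBX η
  | .mid, .mid => rightBB
  | .mid, .tgt => rightBY β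
  | .tgt, .src => fun _ => 0
  | .tgt, .mid => fun _ => 0
  | .tgt, .tgt => rightYY

end RightRep

lemma rightRep_hom_aux {c d : ℚ} {A : Matrix (Fin 2) (Fin 2) ℚ} {B : Matrix (Fin 3) (Fin 3) ℚ}
    {C : Matrix (Fin 1) (Fin 1) ℚ}
    (hδ : (!![0, 0; 0, 1; 0, d] : Matrix (Fin 3) (Fin 2) ℚ) * A =
      B * (!![0, 0; 0, 1; 0, c] : Matrix (Fin 3) (Fin 2) ℚ))
    (hτ : (!![0, 0, 1; 0, 0, 0; 0, 0, 0] : Matrix (Fin 3) (Fin 3) ℚ) * B =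
      B * (!![0, 0, 1; 0, 0, 0; 0, 0, 0] : Matrix (Fin 3) (Fin 3) ℚ))
    (hβ : (!![0, 1, 0] : Matrix (Fin 1) (Fin 3) ℚ) * B =
      C * (!![0, 1, 0] : Matrix (Fin 1) (Fin 3) ℚ))
    (hη : (!![0, 1, 1; 0, 0, 0] : Matrix (Fin 2) (Fin 3) ℚ) * B =
      A * (!![0, 1, 1; 0, 0, 0] : Matrix (Fin 2) (Fin 3) ℚ)) :
    (c = d ∨ C 0 0 = 0) ∧ (A * A = A → B * B = B → C * C = C →
      (A = 0 ∧ B = 0 ∧ C = 0) ∨ (A = 1 ∧ B = 1 ∧ C = 1)) := by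
  simp only [← Matrix.ext_iff, Fin.forall_fin_succ, Matrix.mul_apply, Fin.sum_univ_succ] at *
  simp at *
  constructor
  · grind
  · intros
    have : C 0 0 = 0 ∨ C 0 0 = 1 := by grind
    rcases this with h | h
    · refine .inl ?_
      grind
    · refine .inr ?_
      grind

namespace LoopedContour

variable {x y a b : P.Obj} {α : P.Hom a y} {β : P.Hom b y} {γ : P.Hom x a}
  {δ : P.Hom x b} {ω : P.Hom y a} {η : P.Hom b x} (L : LoopedContour α β γ δ ω η)

include L

set_option linter.unusedSimpArgs false in
set_option maxHeartbeats 1000000 in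
lemma rightRep_comp {l : ℕ} (hl : LongLoopRight β δ η l) (c : ℚ) :
    ∀ (p q r : ThreePoints) (g : P.Hom (threePoints x b y q) (threePoints x b y r))
      (f : P.Hom (threePoints x b y p) (threePoints x b y q)),
      rightRep β δ η c p r (P.comp g f) = rightRep β δ η c q r g * rightRep β δ η c p q f := by
  classical
  have hτ0 := L.tau_ne_zero hl
  have hτ : P.pipow b 1 ≠ P.id b := pipow_ne_id one_ne_zero
  have hlam : P.pipow x 1 ≠ P.id x := pipow_ne_id one_ne_zero
  have hτδ : P.pipow b 1 ⊚ δ ≠ δ := fun h => one_ne_zero (pipow_comp_eq_self L.δ_ne_zero h)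
  have hxyy {g : P.Hom y y} {f : P.Hom x y} : g ⊚ f = β ⊚ δ ↔ g = P.id y ∧ f = β ⊚ δ := by
    rw [← L.comm]; exact L.xyy
  have hxxy {g : P.Hom x y} {f : P.Hom x x} : g ⊚ f = β ⊚ δ ↔ g = β ⊚ δ ∧ f = P.id x := by
    rw [← L.comm]; exact L.xxy
  have hxby {g : P.Hom b y} {f : P.Hom x b} : g ⊚ f = β ⊚ δ ↔ g = β ∧ f = δ := by
    rw [← L.comm]; exact L.right_xby hl
  have H : (∀ (g f : P.Hom x x), rightXX c (g ⊚ f) = rightXX c g * rightXX c f) ∧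
    (∀ (g : P.Hom x b) (f : P.Hom x x), rightXB δ c (g ⊚ f) = rightXB δ c g * rightXX c f) ∧
    (∀ (g : P.Hom x y) (f : P.Hom x x), rightXY β δ (g ⊚ f) = rightXY β δ g * rightXX c f) ∧
    (∀ (g : P.Hom b x) (f : P.Hom x b), rightXX c (g ⊚ f) = rightBX η g * rightXB δ c f) ∧
    (∀ (g : P.Hom b b) (f : P.Hom x b), rightXB δ c (g ⊚ f) = rightBB g * rightXB δ c f) ∧
    (∀ (g : P.Hom b y) (f : P.Hom x b), rightXY β δ (g ⊚ f) = rightBY β g * rightXB δ c f) ∧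
    (∀ (g : P.Hom y x) (f : P.Hom x y), rightXX c (g ⊚ f) = 0) ∧
    (∀ (g : P.Hom y b) (f : P.Hom x y), rightXB δ c (g ⊚ f) = 0) ∧
    (∀ (g : P.Hom y y) (f : P.Hom x y), rightXY β δ (g ⊚ f) = rightYY g * rightXY β δ f) ∧
    (∀ (g : P.Hom x x) (f : P.Hom b x), rightBX η (g ⊚ f) = rightXX c g * rightBX η f) ∧
    (∀ (g : P.Hom x b) (f : P.Hom b x), rightBB (g ⊚ f) = rightXB δ c g * rightBX η f) ∧
    (∀ (g : P.Hom x y) (f : P.Hom b x), rightBY β (g ⊚ f) = rightXY β δ g * rightBX η f) ∧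
    (∀ (g : P.Hom b x) (f : P.Hom b b), rightBX η (g ⊚ f) = rightBX η g * rightBB f) ∧
    (∀ (g : P.Hom b b) (f : P.Hom b b), rightBB (g ⊚ f) = rightBB g * rightBB f) ∧
    (∀ (g : P.Hom b y) (f : P.Hom b b), rightBY β (g ⊚ f) = rightBY β g * rightBB f) ∧
    (∀ (g : P.Hom y x) (f : P.Hom b y), rightBX η (g ⊚ f) = 0) ∧
    (∀ (g : P.Hom y b) (f : P.Hom b y), rightBB (g ⊚ f) = 0) ∧
    (∀ (g : P.Hom y y) (f : P.Hom b y), rightBY β (g ⊚ f) = rightYY g * rightBY β f) ∧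
    (∀ (g : P.Hom x y) (f : P.Hom y x), rightYY (g ⊚ f) = 0) ∧
    (∀ (g : P.Hom b y) (f : P.Hom y b), rightYY (g ⊚ f) = 0) ∧
    (∀ (g : P.Hom y y) (f : P.Hom y y), rightYY (g ⊚ f) = rightYY g * rightYY f) := by
    refine ⟨?_, ?_, ?_, ?_, ?_, ?_, ?_, ?_, ?_, ?_, ?_, ?_, ?_, ?_, ?_, ?_, ?_, ?_, ?_, ?_, ?_⟩
      <;> intro g f
      <;> simp only [rightXX, rightXB, rightXY, rightBX, rightBB, rightBY, rightYY,
        comp_eq_id_iff, comp_ne_id L.x_ne_y, comp_ne_id L.x_ne_b, comp_ne_id L.b_ne_y,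
        comp_ne_id L.x_ne_y.symm, comp_ne_id L.x_ne_b.symm, comp_ne_id L.b_ne_y.symm,
        L.right_xbx hl, L.xyx, L.right_xxb hl, L.right_xxb' hl, L.right_xbb hl, L.right_xbb' hl,
        L.right_xyb hl, L.right_xyb' hl, hxyy, hxxy, hxby, L.right_bxb hl, L.right_byb hl,
        L.right_bxx hl, L.right_bbx hl, L.byx, L.right_bby hl, L.right_byy hl,
        L.comp_ne_β L.x_ne_b L.x_ne_y, comp_eq_pi_iff hτ0, comp_eq_pi_iff L.lam_ne_zero,
        if_false]
      <;> split_ifs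
      <;> try grind only
    all_goals
      first
      | simp only [Matrix.zero_mul, Matrix.mul_zero, Matrix.one_mul, Matrix.mul_one]
      | ext i k
        fin_cases i <;> fin_cases k <;> simp [Matrix.mul_apply, Fin.sum_univ_succ, add_comm]
  obtain ⟨h1, h2, h3, h4, h5, h6, h7, h8, h9, h10, h11, h12, h13, h14, h15, h16, h17, h18, h19,
    h20, h21⟩ := H
  have zero_aux : ∀ {l m n : ℕ} {M : Matrix (Fin l) (Fin n) ℚ} {N : Matrix (Fin m) (Fin n) ℚ},
      M = 0 → M = (0 : Matrix (Fin l) (Fin m) ℚ) * N := fun h => by rw [h, Matrix.zero_mul]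
  have aux_zero : ∀ {l m n : ℕ} {M : Matrix (Fin l) (Fin n) ℚ} {N : Matrix (Fin l) (Fin m) ℚ},
      M = 0 → M = N * (0 : Matrix (Fin m) (Fin n) ℚ) := fun h => by rw [h, Matrix.mul_zero]
  rintro (_ | _ | _) (_ | _ | _) (_ | _ | _) g f
  exacts [h1 g f, h2 g f, h3 g f, h4 g f, h5 g f, h6 g f, zero_aux (h7 g f), zero_aux (h8 g f),
    h9 g f, h10 g f, h11 g f, h12 g f, h13 g f, h14 g f, h15 g f, zero_aux (h16 g f),
    zero_aux (h17 g f), h18 g f, aux_zero rfl, aux_zero rfl, aux_zero (h19 g f), aux_zero rfl,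
    aux_zero rfl, aux_zero (h20 g f), zero_aux rfl, zero_aux rfl, h21 g f]

lemma rightRep_zero {l : ℕ} (hl : LongLoopRight β δ η l) (c : ℚ) (p q : ThreePoints) :
    rightRep β δ η c p q (P.zero _ _) = 0 := by
  cases p <;> cases q
  · exact (if_neg (id_ne_zero x).symm).trans (if_neg L.lam_ne_zero.symm)
  · exact (if_neg L.δ_ne_zero.symm).trans (if_neg (L.tau_δ_ne_zero hl).symm)
  · exact if_neg (L.comm ▸ L.mu_ne_zero.symm)
  · exact if_neg L.η_ne_zero.symm
  · exact (if_neg (id_ne_zero b).symm).trans (if_neg (L.tau_ne_zero hl).symm)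
  · exact if_neg L.β_ne_zero.symm
  · rfl
  · rfl
  · exact if_neg (id_ne_zero y).symm

theorem not_repFin_right {l : ℕ} (hl : LongLoopRight β δ η l) :
    ¬ RepFin P {x, b, y} (IdealOf P (P.pipow y 1 ⊚ α ⊚ γ)) := by
  rw [← range_threePoints]
  refine not_repFin_of_matrices (threePoints_injective L.x_ne_b L.x_ne_y L.b_ne_y) rightDim
    (rightRep β δ η) ?_ (fun c p q r => L.rightRep_comp hl c p q r) (L.rightRep_zero hl)
    (s := .src) (t := .tgt) (P.pipow y 1 ⊚ α ⊚ γ) ?_ two_pos ?_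
  · intro c p
    cases p <;> exact if_pos rfl
  · refine fun c => if_neg fun h => one_ne_zero (pipow_comp_eq_self L.mu_ne_zero ?_)
    rw [h, L.comm]
  · intro c d Φ hΦ
    have hδ := hΦ .src .mid δ
    have hτ := hΦ .mid .mid (P.pipow b 1)
    have hβ := hΦ .mid .tgt β
    have hη := hΦ .mid .src η
    simp only [rightRep, rightXB, rightBB, rightBY, rightBX, if_true,
      if_neg (pipow_ne_id one_ne_zero : P.pipow b 1 ≠ P.id b)] at hδ hτ hβ hη
    obtain ⟨h1, h2⟩ := rightRep_hom_aux hδ hτ hβ hη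
    refine ⟨h1.imp_right fun h => ⟨.tgt, 0, fun i => ?_⟩, fun h => ?_⟩
    · rwa [Subsingleton.elim i 0]
    · refine (h2 (h .src) (h .mid) (h .tgt)).imp ?_ ?_ <;>
        rintro ⟨h3, h4, h5⟩ (_ | _ | _) <;> assumption

end LoopedContour

section GradedRep

variable {V : Type} {o : V → P.Obj} {y : P.Obj} (κ : ∀ p, P.Hom (o p) y) {n : V → ℕ}
  (M0 M1 : ∀ p q, Matrix (Fin (n q)) (Fin (n p)) ℚ)

open Classical in
/-- If every morphism to `y` is a multiple `ρ^i κ_p` with `ρ = π(y)`, then the other morphisms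
have a degree. This is the representation given by `M0` in degree `0` and by `M1` in degree `1`
and vanishing in higher degrees. -/
noncomputable def gradedRep (p q : V) (f : P.Hom (o p) (o q)) :
    Matrix (Fin (n q)) (Fin (n p)) ℚ :=
  if κ q ⊚ f = κ p then M0 p q else if κ q ⊚ f = P.pipow y 1 ⊚ κ p then M1 p q else 0

variable {κ M0 M1} (hgen : ∀ p (f : P.Hom (o p) y), ∃ i, f = P.pipow y i ⊚ κ p)
  (hnz : ∀ p, P.pipow y 1 ⊚ κ p ≠ P.zero _ _)

include hnz in
lemma pipow_comp_eq_iff {p : V} {i : ℕ} : P.pipow y i ⊚ κ p = κ p ↔ i = 0 :=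
  ⟨fun h => pipow_comp_eq_self (right_ne_zero (hnz p)) h, fun h => by rw [h, pipow_zero_comp]⟩

include hnz in
lemma pipow_comp_eq_pi_iff {p : V} {i : ℕ} :
    P.pipow y i ⊚ κ p = P.pipow y 1 ⊚ κ p ↔ i = 1 :=
  ⟨fun h => (pipow_comp_inj h.symm (hnz p)).symm, fun h => by rw [h]⟩

include hnz in
lemma gradedRep_eq {p q : V} {f : P.Hom (o p) (o q)} {i : ℕ}
    (h : κ q ⊚ f = P.pipow y i ⊚ κ p) :
    gradedRep κ M0 M1 p q f = if i = 0 then M0 p q else if i = 1 then M1 p q else 0 := by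
  simp only [gradedRep, h, pipow_comp_eq_iff hnz, pipow_comp_eq_pi_iff hnz]

include hgen hnz in
lemma gradedRep_comp
    (H00 : ∀ p q r (g : P.Hom (o q) (o r)) (f : P.Hom (o p) (o q)), κ r ⊚ g = κ q →
      κ q ⊚ f = κ p → M0 p r = M0 q r * M0 p q)
    (H01 : ∀ p q r (g : P.Hom (o q) (o r)) (f : P.Hom (o p) (o q)), κ r ⊚ g = κ q →
      κ q ⊚ f = P.pipow y 1 ⊚ κ p → M1 p r = M0 q r * M1 p q)
    (H10 : ∀ p q r (g : P.Hom (o q) (o r)) (f : P.Hom (o p) (o q)),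
      κ r ⊚ g = P.pipow y 1 ⊚ κ q → κ q ⊚ f = κ p → M1 p r = M1 q r * M0 p q)
    (H11 : ∀ p q r (g : P.Hom (o q) (o r)) (f : P.Hom (o p) (o q)),
      κ r ⊚ g = P.pipow y 1 ⊚ κ q → κ q ⊚ f = P.pipow y 1 ⊚ κ p → M1 q r * M1 p q = 0)
    (p q r : V) (g : P.Hom (o q) (o r)) (f : P.Hom (o p) (o q)) :
    gradedRep κ M0 M1 p r (g ⊚ f) = gradedRep κ M0 M1 q r g * gradedRep κ M0 M1 p q f := by
  obtain ⟨i, hi⟩ := hgen p (κ q ⊚ f)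
  obtain ⟨j, hj⟩ := hgen q (κ r ⊚ g)
  have hij : κ r ⊚ g ⊚ f = P.pipow y (j + i) ⊚ κ p := by
    rw [reassoc hj, P.assoc, hi, pipow_comp_pipow_comp]
  rw [gradedRep_eq hnz hi, gradedRep_eq hnz hj, gradedRep_eq hnz hij]
  rcases i with _ | _ | i
  · rw [pipow_zero_comp] at hi
    rcases j with _ | _ | j
    · rw [pipow_zero_comp] at hj
      simpa using H00 p q r g f hj hi
    · simpa using H10 p q r g f hj hi
    · simp
  · rcases j with _ | _ | j
    · rw [pipow_zero_comp] at hj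
      simpa using H01 p q r g f hj hi
    · simpa using (H11 p q r g f hj hi).symm
    · simp
  · have h : j + (i + 1 + 1) ≠ 1 := by omega
    simp [h]

end GradedRep

theorem not_repFin_of_graded {V : Type} [Finite V] {o : V → P.Obj} (ho : Function.Injective o)
    {y : P.Obj} {κ : ∀ p, P.Hom (o p) y}
    (hgen : ∀ p (f : P.Hom (o p) y), ∃ i, f = P.pipow y i ⊚ κ p)
    (hnz : ∀ p, P.pipow y 1 ⊚ κ p ≠ P.zero _ _)
    (E0 E1 : V → V → Prop)
    (hE0 : ∀ p q (f : P.Hom (o p) (o q)), κ q ⊚ f = κ p → E0 p q)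
    (hE1 : ∀ p q (f : P.Hom (o p) (o q)), κ q ⊚ f = P.pipow y 1 ⊚ κ p → E1 p q)
    (n : V → ℕ) (M0 M1 : ℚ → ∀ p q, Matrix (Fin (n q)) (Fin (n p)) ℚ)
    (hid : ∀ c p, M0 c p p = 1)
    (H00 : ∀ c p q r, E0 q r → E0 p q → M0 c p r = M0 c q r * M0 c p q)
    (H01 : ∀ c p q r, E0 q r → E1 p q → E1 p r → M1 c p r = M0 c q r * M1 c p q)
    (H10 : ∀ c p q r, E1 q r → E0 p q → E1 p r → M1 c p r = M1 c q r * M0 c p q)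
    (H11 : ∀ c p q r, E1 q r → E1 p q → M1 c q r * M1 c p q = 0)
    {s t : V} (nu : P.Hom (o s) (o t)) (hnu : κ t ⊚ nu = P.pipow y 1 ⊚ κ s)
    (hM1 : ∀ c, M1 c s t = 0) (hs : 0 < n s)
    (hhom : ∀ c d (Φ : ∀ p, Matrix (Fin (n p)) (Fin (n p)) ℚ),
      (∀ p q (f : P.Hom (o p) (o q)), κ q ⊚ f = κ p → M0 d p q * Φ p = Φ q * M0 c p q) →
      (∀ p q (f : P.Hom (o p) (o q)), κ q ⊚ f = P.pipow y 1 ⊚ κ p →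
        M1 d p q * Φ p = Φ q * M1 c p q) →
      (c = d ∨ ∃ p j, ∀ i, Φ p i j = 0) ∧
        ((∀ p, Φ p * Φ p = Φ p) → (∀ p, Φ p = 0) ∨ ∀ p, Φ p = 1)) :
    ¬ RepFin P (Set.range o) (IdealOf P nu) := by
  have h1 : ∀ {p q} {f : P.Hom (o p) (o q)}, κ q ⊚ f = κ p →
      κ q ⊚ f = P.pipow y 0 ⊚ κ p := fun h => by rw [h, pipow_zero_comp]
  refine not_repFin_of_matrices ho n (fun c => gradedRep κ (M0 c) (M1 c)) ?_
    (fun c p q r g f => gradedRep_comp hgen hnz ?_ ?_ ?_ ?_ p q r g f) ?_ nu ?_ hs ?_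
  · intro c p
    rw [gradedRep, if_pos (P.comp_id _), hid]
  · exact fun p q r g f hg hf => H00 c p q r (hE0 _ _ g hg) (hE0 _ _ f hf)
  · exact fun p q r g f hg hf => H01 c p q r (hE0 _ _ g hg) (hE1 _ _ f hf)
      (hE1 p r (g ⊚ f) (by rw [reassoc hg, hf]))
  · exact fun p q r g f hg hf => H10 c p q r (hE1 _ _ g hg) (hE0 _ _ f hf)
      (hE1 p r (g ⊚ f) (by rw [reassoc hg, P.assoc, hf]))
  · exact fun p q r g f hg hf => H11 c p q r (hE1 _ _ g hg) (hE1 _ _ f hf)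
  · intro c p q
    rw [gradedRep, P.comp_zero, if_neg (right_ne_zero (hnz p)).symm, if_neg (hnz p).symm]
  · intro c
    simp [gradedRep_eq hnz hnu, hM1]
  · intro c d Φ hΦ
    refine hhom c d Φ (fun p q f hf => ?_) (fun p q f hf => ?_)
    · simpa [gradedRep_eq hnz (h1 hf)] using hΦ p q f
    · simpa [gradedRep_eq hnz hf] using hΦ p q f

/-- The index type of the points of a full subcategory with four points. -/
inductive FourPoints
  | src
  | fst
  | snd
  | tgt

instance : Finite FourPoints :=
  Finite.of_injective (fun | .src => (0 : Fin 4) | .fst => 1 | .snd => 2 | .tgt => 3)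
    (by intro p q; cases p <;> cases q <;> simp)

/-- The four given points. -/
abbrev fourPoints (x a b y : P.Obj) : FourPoints → P.Obj
  | .src => x
  | .fst => a
  | .snd => b
  | .tgt => y

lemma range_fourPoints (x a b y : P.Obj) : Set.range (fourPoints x a b y) = {x, a, b, y} := by
  ext w
  constructor
  · rintro ⟨p, rfl⟩
    cases p <;> simp [fourPoints]
  · rintro (rfl | rfl | rfl | rfl)
    exacts [⟨.src, rfl⟩, ⟨.fst, rfl⟩, ⟨.snd, rfl⟩, ⟨.tgt, rfl⟩]

/-- The chosen morphisms from the four points to `y`. -/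
def fourTo {x a b y : P.Obj} (α : P.Hom a y) (β : P.Hom b y) (γ : P.Hom x a) :
    ∀ p, P.Hom (fourPoints x a b y p) y
  | .src => α ⊚ γ
  | .fst => α
  | .snd => β
  | .tgt => P.id y

/-- The pairs of points between which there can be a morphism of degree `0`. -/
def degZero : FourPoints → FourPoints → Bool
  | .src, _ => true
  | _, .src => false
  | .fst, .snd => false
  | .snd, .fst => false
  | .tgt, .fst => false
  | .tgt, .snd => false
  | _, _ => true

/-- The pairs of points between which there can be a morphism of degree `1`, where `eab` and `eyb`
tell whether there can be one from `a` or `y` to `b`. -/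
def degOne (eab eyb : Bool) : FourPoints → FourPoints → Bool
  | .fst, .src => false
  | .tgt, .src => false
  | .fst, .snd => eab
  | .tgt, .snd => eyb
  | _, _ => true

namespace LoopedContour

variable {x y a b : P.Obj} {α : P.Hom a y} {β : P.Hom b y} {γ : P.Hom x a}
  {δ : P.Hom x b} {ω : P.Hom y a} {η : P.Hom b x} (L : LoopedContour α β γ δ ω η)

include L

lemma fourPoints_injective : Function.Injective (fourPoints x a b y) := by
  have h1 := L.x_ne_a
  have h2 := L.x_ne_b
  have h3 := L.x_ne_y
  have h4 := L.a_ne_b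
  have h5 := L.a_ne_y
  have h6 := L.b_ne_y
  intro p q h
  cases p <;> cases q <;> simp_all [fourPoints]

lemma rho_β_ne_zero : P.pipow y 1 ⊚ β ≠ P.zero b y := by
  have := L.nz
  rw [L.comm, ← P.assoc] at this
  exact left_ne_zero this

lemma fourTo_gen (hα : ∀ f : P.Hom a y, ∃ i, f = P.pipow y i ⊚ α)
    (hβ : ∀ f : P.Hom b y, ∃ i, f = P.pipow y i ⊚ β) :
    ∀ p (f : P.Hom (fourPoints x a b y p) y), ∃ i, f = P.pipow y i ⊚ fourTo α β γ p
  | .src, f => L.mu_generates f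
  | .fst, f => hα f
  | .snd, f => hβ f
  | .tgt, f => by
    obtain ⟨i, hi⟩ := P.endo_cyclic _ f
    exact ⟨i, by rw [fourTo, P.comp_id, hi]⟩

lemma pi_fourTo_ne_zero : ∀ p, P.pipow y 1 ⊚ fourTo α β γ p ≠ P.zero _ _
  | .src => L.nz
  | .fst => L.rho_α_ne_zero
  | .snd => L.rho_β_ne_zero
  | .tgt => by
    rw [fourTo, P.comp_id]
    exact L.rho_ne_zero

lemma degZero_of_comp (p q : FourPoints)
    (f : P.Hom (fourPoints x a b y p) (fourPoints x a b y q))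
    (h : fourTo α β γ q ⊚ f = fourTo α β γ p) : degZero p q := by
  cases p <;> cases q <;> first | rfl | (exfalso; simp only [fourTo] at f h)
  · rw [P.assoc, comp_eq_self_iff_right L.α_ne_zero] at h
    exact comp_ne_id L.x_ne_a.symm _ _ h
  · exact L.comp_ne_α L.a_ne_b.symm L.b_ne_y _ _ h
  · rw [P.assoc] at h
    exact L.comp_ne_β L.a_ne_b L.a_ne_y _ _ h
  · exact L.comp_ne_β L.a_ne_b L.a_ne_y _ _ h
  · exact comp_ne_id L.x_ne_y.symm _ _ h
  · exact comp_ne_id L.a_ne_y.symm _ _ h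
  · exact comp_ne_id L.b_ne_y.symm _ _ h

lemma degOne_of_comp {eab eyb : Bool}
    (hab : ∀ f : P.Hom a b, β ⊚ f = P.pipow y 1 ⊚ α → eab)
    (hyb : ∀ f : P.Hom y b, β ⊚ f = P.pipow y 1 → eyb) (p q : FourPoints)
    (f : P.Hom (fourPoints x a b y p) (fourPoints x a b y q))
    (h : fourTo α β γ q ⊚ f = P.pipow y 1 ⊚ fourTo α β γ p) : degOne eab eyb p q := by
  cases p <;> cases q <;> first | rfl | simp only [fourTo] at f h
  · have h0 := L.rho_α_ne_zero
    rw [P.assoc] at h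
    rw [L.rho, P.assoc] at h h0
    exact absurd (cancel_left h (h ▸ h0)).symm (L.not_ωα f)
  · exact hab f h
  · have h0 := L.rho_ne_zero
    rw [P.assoc, P.comp_id] at h
    rw [L.rho] at h h0
    exact absurd (by rw [← P.assoc, cancel_left h (h ▸ h0)]) (L.not_ωα (f ⊚ α))
  · exact hyb f (by rw [h, P.comp_id])

lemma fourTo_src_comp_η : fourTo α β γ .src ⊚ η = P.pipow y 1 ⊚ fourTo α β γ .snd := by
  rw [fourTo, fourTo, P.assoc, ← L.sq, L.rho, P.assoc]

end LoopedContour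

section FourRepOne

/-- The degree `0` part of a family of representations of dimension one at each point. -/
def oneDegZero : FourPoints → FourPoints → Matrix (Fin 1) (Fin 1) ℚ
  | .src, .src => 1
  | .fst, .fst => 1
  | .snd, .snd => 1
  | .tgt, .tgt => 1
  | .src, .fst => 1
  | .src, .snd => 1
  | _, _ => 0

/-- The degree `1` part of a family of representations of dimension one at each point. -/
def oneDegOne (c : ℚ) : FourPoints → FourPoints → Matrix (Fin 1) (Fin 1) ℚ
  | .tgt, .fst => 1
  | .tgt, .snd => !![c]
  | _, _ => 0

end FourRepOne

namespace LoopedContour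

variable {x y a b : P.Obj} {α : P.Hom a y} {β : P.Hom b y} {γ : P.Hom x a}
  {δ : P.Hom x b} {ω : P.Hom y a} {η : P.Hom b x} (L : LoopedContour α β γ δ ω η)

include L

theorem not_repFin_of_factor_snd (hα : ∀ f : P.Hom a y, ∃ i, f = P.pipow y i ⊚ α)
    (hβ : ∀ f : P.Hom b y, ∃ i, f = P.pipow y i ⊚ β) {χ : P.Hom y b}
    (hχ : β ⊚ χ = P.pipow y 1) :
    ¬ RepFin P {x, a, b, y} (IdealOf P (P.pipow y 1 ⊚ α ⊚ γ)) := by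
  rw [← range_fourPoints]
  refine not_repFin_of_graded L.fourPoints_injective (L.fourTo_gen hα hβ) L.pi_fourTo_ne_zero
    (fun p q => degZero p q) (fun p q => degOne true true p q) L.degZero_of_comp
    (L.degOne_of_comp (fun _ _ => rfl) (fun _ _ => rfl)) (fun _ => 1) (fun _ => oneDegZero)
    oneDegOne ?_ ?_ ?_ ?_ ?_ (s := .src) (t := .tgt) (P.pipow y 1 ⊚ α ⊚ γ) (P.id_comp _)
    (fun _ => rfl) one_pos ?_
  · rintro c (_ | _ | _ | _) <;> rfl
  · rintro c (_ | _ | _ | _) (_ | _ | _ | _) (_ | _ | _ | _) h1 h2 <;>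
      first
      | exact absurd h1 (by decide)
      | exact absurd h2 (by decide)
      | simp [oneDegZero]
  · rintro c (_ | _ | _ | _) (_ | _ | _ | _) (_ | _ | _ | _) h1 h2 h3 <;>
      first
      | exact absurd h1 (by decide)
      | exact absurd h2 (by decide)
      | exact absurd h3 (by decide)
      | simp [oneDegZero, oneDegOne]
  · rintro c (_ | _ | _ | _) (_ | _ | _ | _) (_ | _ | _ | _) h1 h2 h3 <;>
      first
      | exact absurd h1 (by decide)
      | exact absurd h2 (by decide)
      | exact absurd h3 (by decide)
      | simp [oneDegZero, oneDegOne]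
  · rintro c (_ | _ | _ | _) (_ | _ | _ | _) (_ | _ | _ | _) h1 h2 <;>
      first
      | exact absurd h1 (by decide)
      | exact absurd h2 (by decide)
      | simp [oneDegOne]
  · intro c d Φ h0 h1
    have hγ := h0 .src .fst γ rfl
    have hδ := h0 .src .snd δ L.comm.symm
    have hω := h1 .tgt .fst ω (by rw [fourTo, fourTo, P.comp_id, L.rho])
    have hχ := h1 .tgt .snd χ (by rw [fourTo, fourTo, P.comp_id, hχ])
    simp only [oneDegZero, oneDegOne, Matrix.one_mul, Matrix.mul_one] at hγ hδ hω hχ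
    have hχ' := congrFun (congrFun hχ 0) 0
    simp only [Matrix.mul_apply, Fin.sum_univ_succ] at hχ'
    rw [hω, ← hγ, ← hδ] at hχ'
    have h2 : c = d ∨ Φ .src 0 0 = 0 := by
      simp at hχ'
      grind
    refine ⟨h2.imp_right fun h => ⟨.src, 0, fun i => ?_⟩, fun h => ?_⟩
    · rwa [Subsingleton.elim i 0]
    · have h3 : Φ .src 0 0 = 0 ∨ Φ .src 0 0 = 1 := by
        have := congrFun (congrFun (h .src) 0) 0
        simp [Matrix.mul_apply] at this
        grind
      have h4 : Φ .tgt = Φ .src := by rw [hω, hγ]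
      refine h3.imp (fun h3 => ?_) (fun h3 => ?_)
      · have h5 : Φ .src = 0 := by
          ext i j; rw [Subsingleton.elim i 0, Subsingleton.elim j 0, h3]; rfl
        rintro (_ | _ | _ | _)
        exacts [h5, hγ ▸ h5, hδ ▸ h5, h4 ▸ h5]
      · have h5 : Φ .src = 1 := by
          ext i j; rw [Subsingleton.elim i 0, Subsingleton.elim j 0, h3]; rfl
        rintro (_ | _ | _ | _)
        exacts [h5, hγ ▸ h5, hδ ▸ h5, h4 ▸ h5]

end LoopedContour

section FourRepTwo

/-- The dimensions of a family of representations. -/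
abbrev twoDim : FourPoints → ℕ
  | .snd => 2
  | _ => 1

/-- The degree `0` part of a family of representations. -/
def twoDegZero : ∀ p q : FourPoints, Matrix (Fin (twoDim q)) (Fin (twoDim p)) ℚ
  | .src, .src => (1 : Matrix (Fin 1) (Fin 1) ℚ)
  | .fst, .fst => (1 : Matrix (Fin 1) (Fin 1) ℚ)
  | .snd, .snd => (1 : Matrix (Fin 2) (Fin 2) ℚ)
  | .tgt, .tgt => (1 : Matrix (Fin 1) (Fin 1) ℚ)
  | .fst, .tgt => (1 : Matrix (Fin 1) (Fin 1) ℚ)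
  | .snd, .tgt => (!![1, 0] : Matrix (Fin 1) (Fin 2) ℚ)
  | .src, .snd => (!![0; 1] : Matrix (Fin 2) (Fin 1) ℚ)
  | .src, .fst => (0 : Matrix (Fin 1) (Fin 1) ℚ)
  | .src, .tgt => (0 : Matrix (Fin 1) (Fin 1) ℚ)
  | .fst, .src => (0 : Matrix (Fin 1) (Fin 1) ℚ)
  | .fst, .snd => (0 : Matrix (Fin 2) (Fin 1) ℚ)
  | .snd, .src => (0 : Matrix (Fin 1) (Fin 2) ℚ)
  | .snd, .fst => (0 : Matrix (Fin 1) (Fin 2) ℚ)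
  | .tgt, .src => (0 : Matrix (Fin 1) (Fin 1) ℚ)
  | .tgt, .fst => (0 : Matrix (Fin 1) (Fin 1) ℚ)
  | .tgt, .snd => (0 : Matrix (Fin 2) (Fin 1) ℚ)

/-- The degree `1` part of a family of representations. -/
def twoDegOne (c : ℚ) : ∀ p q : FourPoints, Matrix (Fin (twoDim q)) (Fin (twoDim p)) ℚ
  | .snd, .src => (!![1, 0] : Matrix (Fin 1) (Fin 2) ℚ)
  | .snd, .snd => (!![0, 0; 1, 0] : Matrix (Fin 2) (Fin 2) ℚ)
  | .fst, .snd => (!![0; c] : Matrix (Fin 2) (Fin 1) ℚ)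
  | .src, .src => (0 : Matrix (Fin 1) (Fin 1) ℚ)
  | .src, .fst => (0 : Matrix (Fin 1) (Fin 1) ℚ)
  | .src, .snd => (0 : Matrix (Fin 2) (Fin 1) ℚ)
  | .src, .tgt => (0 : Matrix (Fin 1) (Fin 1) ℚ)
  | .fst, .src => (0 : Matrix (Fin 1) (Fin 1) ℚ)
  | .fst, .fst => (0 : Matrix (Fin 1) (Fin 1) ℚ)
  | .fst, .tgt => (0 : Matrix (Fin 1) (Fin 1) ℚ)
  | .snd, .fst => (0 : Matrix (Fin 1) (Fin 2) ℚ)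
  | .snd, .tgt => (0 : Matrix (Fin 1) (Fin 2) ℚ)
  | .tgt, .src => (0 : Matrix (Fin 1) (Fin 1) ℚ)
  | .tgt, .fst => (0 : Matrix (Fin 1) (Fin 1) ℚ)
  | .tgt, .snd => (0 : Matrix (Fin 2) (Fin 1) ℚ)
  | .tgt, .tgt => (0 : Matrix (Fin 1) (Fin 1) ℚ)

lemma twoDegZero_comp (p q r : FourPoints) (h1 : degZero q r) (h2 : degZero p q) :
    twoDegZero p r = twoDegZero q r * twoDegZero p q := by
  revert h1 h2
  rcases p with _ | _ | _ | _ <;> rcases q with _ | _ | _ | _ <;> rcases r with _ | _ | _ | _ <;>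
    intro h1 h2 <;>
    first
    | exact absurd h1 (by decide)
    | exact absurd h2 (by decide)
    | (dsimp only [twoDim, twoDegZero]
       simp [← Matrix.ext_iff])

lemma twoDegZero_comp_one (c : ℚ) (p q r : FourPoints) (h1 : degZero q r)
    (h2 : degOne true false p q) (h3 : degOne true false p r) :
    twoDegOne c p r = twoDegZero q r * twoDegOne c p q := by
  revert h1 h2 h3
  rcases p with _ | _ | _ | _ <;> rcases q with _ | _ | _ | _ <;> rcases r with _ | _ | _ | _ <;>
    intro h1 h2 h3 <;>
    first
    | exact absurd h1 (by decide)
    | exact absurd h2 (by decide)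
    | exact absurd h3 (by decide)
    | (dsimp only [twoDim, twoDegZero, twoDegOne]
       simp [← Matrix.ext_iff, Fin.forall_fin_succ])

lemma twoDegOne_comp_zero (c : ℚ) (p q r : FourPoints) (h1 : degOne true false q r)
    (h2 : degZero p q) (h3 : degOne true false p r) :
    twoDegOne c p r = twoDegOne c q r * twoDegZero p q := by
  revert h1 h2 h3
  rcases p with _ | _ | _ | _ <;> rcases q with _ | _ | _ | _ <;> rcases r with _ | _ | _ | _ <;>
    intro h1 h2 h3 <;>
    first
    | exact absurd h1 (by decide)
    | exact absurd h2 (by decide)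
    | exact absurd h3 (by decide)
    | (dsimp only [twoDim, twoDegZero, twoDegOne]
       simp [← Matrix.ext_iff, Fin.forall_fin_succ])

lemma twoDegOne_comp_one (c : ℚ) (p q r : FourPoints) (h1 : degOne true false q r)
    (h2 : degOne true false p q) : twoDegOne c q r * twoDegOne c p q = 0 := by
  revert h1 h2
  rcases p with _ | _ | _ | _ <;> rcases q with _ | _ | _ | _ <;> rcases r with _ | _ | _ | _ <;>
    intro h1 h2 <;>
    first
    | exact absurd h1 (by decide)
    | exact absurd h2 (by decide)
    | (dsimp only [twoDim, twoDegOne]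
       simp [← Matrix.ext_iff, Fin.forall_fin_succ])

lemma two_hom {c d : ℚ} {A X Y : Matrix (Fin 1) (Fin 1) ℚ} {B : Matrix (Fin 2) (Fin 2) ℚ}
    (hα : 1 * A = Y * 1)
    (hβ : (!![1, 0] : Matrix (Fin 1) (Fin 2) ℚ) * B = Y * (!![1, 0] : Matrix (Fin 1) (Fin 2) ℚ))
    (hδ : (!![0; 1] : Matrix (Fin 2) (Fin 1) ℚ) * X = B * (!![0; 1] : Matrix (Fin 2) (Fin 1) ℚ))
    (hη : (!![1, 0] : Matrix (Fin 1) (Fin 2) ℚ) * B = X * (!![1, 0] : Matrix (Fin 1) (Fin 2) ℚ))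
    (hf : (!![0; d] : Matrix (Fin 2) (Fin 1) ℚ) * A = B * !![0; c]) :
    (c = d ∨ ∀ i, A i 0 = 0) ∧ (A * A = A → B * B = B → X * X = X → Y * Y = Y →
      (X = 0 ∧ A = 0 ∧ B = 0 ∧ Y = 0) ∨ (X = 1 ∧ A = 1 ∧ B = 1 ∧ Y = 1)) := by
  simp only [← Matrix.ext_iff, Fin.forall_fin_succ, Matrix.mul_apply, Fin.sum_univ_succ] at *
  simp at *
  constructor
  · grind
  · intros
    have h : A 0 0 = 0 ∨ A 0 0 = 1 := by grind
    rcases h with h | h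
    · refine .inl ?_
      grind
    · refine .inr ?_
      grind

end FourRepTwo

namespace LoopedContour

variable {x y a b : P.Obj} {α : P.Hom a y} {β : P.Hom b y} {γ : P.Hom x a}
  {δ : P.Hom x b} {ω : P.Hom y a} {η : P.Hom b x} (L : LoopedContour α β γ δ ω η)

include L

theorem not_repFin_of_factor_fst (hα : ∀ f : P.Hom a y, ∃ i, f = P.pipow y i ⊚ α)
    (hβ : ∀ f : P.Hom b y, ∃ i, f = P.pipow y i ⊚ β)
    (hyb : ∀ f : P.Hom y b, β ⊚ f ≠ P.pipow y 1) {f : P.Hom a b}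
    (hf : β ⊚ f = P.pipow y 1 ⊚ α) :
    ¬ RepFin P {x, a, b, y} (IdealOf P (P.pipow y 1 ⊚ α ⊚ γ)) := by
  rw [← range_fourPoints]
  refine not_repFin_of_graded L.fourPoints_injective (L.fourTo_gen hα hβ) L.pi_fourTo_ne_zero
    (fun p q => degZero p q) (fun p q => degOne true false p q) L.degZero_of_comp
    (L.degOne_of_comp (fun _ _ => rfl) (fun f h => absurd h (hyb f))) twoDim
    (fun _ => twoDegZero) twoDegOne ?_ (fun _ => twoDegZero_comp) twoDegZero_comp_one
    twoDegOne_comp_zero twoDegOne_comp_one (s := .src) (t := .tgt) (P.pipow y 1 ⊚ α ⊚ γ)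
    (P.id_comp _) (fun _ => rfl) one_pos ?_
  · rintro c (_ | _ | _ | _) <;> rfl
  · intro c d Φ h0 h1
    have h := two_hom (h0 .fst .tgt α (P.id_comp _)) (h0 .snd .tgt β (P.id_comp _))
      (h0 .src .snd δ L.comm.symm) (h1 .snd .src η L.fourTo_src_comp_η) (h1 .fst .snd f hf)
    refine ⟨h.1.imp_right fun h => ⟨.fst, 0, h⟩, fun hi => ?_⟩
    refine (h.2 (hi .fst) (hi .snd) (hi .src) (hi .tgt)).imp ?_ ?_ <;>
      rintro ⟨h1, h2, h3, h4⟩ (_ | _ | _ | _)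
    exacts [h1, h2, h3, h4, h1, h2, h3, h4]

end LoopedContour

section FourRepFour

/-- The degree `0` part of a family of representations of dimension four at each point. -/
def fourDegZero (c : ℚ) : FourPoints → FourPoints → Matrix (Fin 4) (Fin 4) ℚ
  | .src, .src => 1
  | .fst, .fst => 1
  | .snd, .snd => 1
  | .tgt, .tgt => 1
  | .fst, .tgt => !![1, 0, 0, 0; 0, 0, 0, 0; 0, 1, 0, 1; 0, 0, 1, 1]
  | .snd, .tgt => !![0, 0, 0, 0; 0, 0, 0, 0; 0, 1, 1, 0; 1, 1, c, 0]
  | .src, .fst => !![0, 0, 0, 0; 0, 0, 0, 0; 1, 0, 0, 0; 0, 1, 0, 0]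
  | .src, .snd => !![1, 0, 0, 0; 0, 1, 0, 0; 0, 0, 0, 0; 0, 0, 1, 0]
  | .src, .tgt => !![0, 0, 0, 0; 0, 0, 0, 0; 0, 1, 0, 0; 1, 1, 0, 0]
  | _, _ => 0

/-- The degree `1` part of a family of representations of dimension four at each point. -/
def fourDegOne : FourPoints → FourPoints → Matrix (Fin 4) (Fin 4) ℚ
  | .tgt, .fst => !![0, 0, 0, 0; 1, 0, 0, 0; 0, 1, 0, 0; 0, 0, 0, 0]
  | .snd, .src => !![0, 0, 0, 0; 0, 0, 0, 0; 1, 0, 0, 0; 0, 1, 0, 0]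
  | .src, .src => !![0, 0, 0, 0; 0, 0, 0, 0; 1, 0, 0, 0; 0, 1, 0, 0]
  | .fst, .fst => !![0, 0, 0, 0; 1, 0, 0, 0; 0, 0, 0, 0; 0, 0, 0, 0]
  | .fst, .tgt => !![0, 0, 0, 0; 0, 0, 0, 0; 1, 0, 0, 0; 0, 0, 0, 0]
  | .tgt, .tgt => !![0, 0, 0, 0; 0, 0, 0, 0; 1, 0, 0, 0; 0, 1, 0, 0]
  | .snd, .snd => !![0, 0, 0, 0; 0, 0, 0, 0; 0, 0, 0, 0; 1, 0, 0, 0]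
  | .src, .snd => !![0, 0, 0, 0; 0, 0, 0, 0; 0, 0, 0, 0; 1, 0, 0, 0]
  | _, _ => 0

lemma fourDegZero_comp (c : ℚ) (p q r : FourPoints) (h1 : degZero q r) (h2 : degZero p q) :
    fourDegZero c p r = fourDegZero c q r * fourDegZero c p q := by
  revert h1 h2
  rcases p with _ | _ | _ | _ <;> rcases q with _ | _ | _ | _ <;> rcases r with _ | _ | _ | _ <;>
    intro h1 h2 <;>
    first
    | exact absurd h1 (by decide)
    | exact absurd h2 (by decide)
    | exact (Matrix.mul_one _).symm
    | exact (Matrix.one_mul _).symm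
    | exact (Matrix.mul_zero _).symm
    | exact (Matrix.zero_mul _).symm
    | (ext i k; revert i k
       simp [fourDegZero, Fin.forall_fin_succ, Matrix.mul_apply, Fin.sum_univ_succ])

lemma fourDegZero_comp_one (c : ℚ) (p q r : FourPoints) (h1 : degZero q r)
    (h2 : degOne false false p q) (h3 : degOne false false p r) :
    fourDegOne p r = fourDegZero c q r * fourDegOne p q := by
  revert h1 h2 h3
  rcases p with _ | _ | _ | _ <;> rcases q with _ | _ | _ | _ <;> rcases r with _ | _ | _ | _ <;>
    intro h1 h2 h3 <;>
    first
    | exact absurd h1 (by decide)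
    | exact absurd h2 (by decide)
    | exact absurd h3 (by decide)
    | exact (Matrix.mul_one _).symm
    | exact (Matrix.one_mul _).symm
    | exact (Matrix.mul_zero _).symm
    | exact (Matrix.zero_mul _).symm
    | (ext i k; revert i k
       simp [fourDegZero, fourDegOne, Fin.forall_fin_succ, Matrix.mul_apply, Fin.sum_univ_succ])

lemma fourDegOne_comp_zero (c : ℚ) (p q r : FourPoints) (h1 : degOne false false q r)
    (h2 : degZero p q) (h3 : degOne false false p r) :
    fourDegOne p r = fourDegOne q r * fourDegZero c p q := by
  revert h1 h2 h3
  rcases p with _ | _ | _ | _ <;> rcases q with _ | _ | _ | _ <;> rcases r with _ | _ | _ | _ <;>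
    intro h1 h2 h3 <;>
    first
    | exact absurd h1 (by decide)
    | exact absurd h2 (by decide)
    | exact absurd h3 (by decide)
    | exact (Matrix.mul_one _).symm
    | exact (Matrix.one_mul _).symm
    | exact (Matrix.mul_zero _).symm
    | exact (Matrix.zero_mul _).symm
    | (ext i k; revert i k
       simp [fourDegZero, fourDegOne, Fin.forall_fin_succ, Matrix.mul_apply, Fin.sum_univ_succ])

lemma fourDegOne_comp_one (p q r : FourPoints) (h1 : degOne false false q r)
    (h2 : degOne false false p q) : fourDegOne q r * fourDegOne p q = 0 := by
  revert h1 h2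
  rcases p with _ | _ | _ | _ <;> rcases q with _ | _ | _ | _ <;> rcases r with _ | _ | _ | _ <;>
    intro h1 h2 <;>
    first
    | exact absurd h1 (by decide)
    | exact absurd h2 (by decide)
    | exact Matrix.mul_zero _
    | exact Matrix.zero_mul _
    | (ext i k; revert i k
       simp [fourDegOne, Fin.forall_fin_succ, Matrix.mul_apply, Fin.sum_univ_succ])

lemma four_hom {c d : ℚ} {A B X Y : Matrix (Fin 4) (Fin 4) ℚ}
    (hα : (!![1, 0, 0, 0; 0, 0, 0, 0; 0, 1, 0, 1; 0, 0, 1, 1] : Matrix (Fin 4) (Fin 4) ℚ) * A =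
      Y * (!![1, 0, 0, 0; 0, 0, 0, 0; 0, 1, 0, 1; 0, 0, 1, 1] : Matrix (Fin 4) (Fin 4) ℚ))
    (hβ : (!![0, 0, 0, 0; 0, 0, 0, 0; 0, 1, 1, 0; 1, 1, d, 0] : Matrix (Fin 4) (Fin 4) ℚ) * B =
      Y * (!![0, 0, 0, 0; 0, 0, 0, 0; 0, 1, 1, 0; 1, 1, c, 0] : Matrix (Fin 4) (Fin 4) ℚ))
    (hγ : (!![0, 0, 0, 0; 0, 0, 0, 0; 1, 0, 0, 0; 0, 1, 0, 0] : Matrix (Fin 4) (Fin 4) ℚ) * X =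
      A * (!![0, 0, 0, 0; 0, 0, 0, 0; 1, 0, 0, 0; 0, 1, 0, 0] : Matrix (Fin 4) (Fin 4) ℚ))
    (hδ : (!![1, 0, 0, 0; 0, 1, 0, 0; 0, 0, 0, 0; 0, 0, 1, 0] : Matrix (Fin 4) (Fin 4) ℚ) * X =
      B * (!![1, 0, 0, 0; 0, 1, 0, 0; 0, 0, 0, 0; 0, 0, 1, 0] : Matrix (Fin 4) (Fin 4) ℚ))
    (hω : (!![0, 0, 0, 0; 1, 0, 0, 0; 0, 1, 0, 0; 0, 0, 0, 0] : Matrix (Fin 4) (Fin 4) ℚ) * Y =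
      A * (!![0, 0, 0, 0; 1, 0, 0, 0; 0, 1, 0, 0; 0, 0, 0, 0] : Matrix (Fin 4) (Fin 4) ℚ))
    (hη : (!![0, 0, 0, 0; 0, 0, 0, 0; 1, 0, 0, 0; 0, 1, 0, 0] : Matrix (Fin 4) (Fin 4) ℚ) * B =
      X * (!![0, 0, 0, 0; 0, 0, 0, 0; 1, 0, 0, 0; 0, 1, 0, 0] : Matrix (Fin 4) (Fin 4) ℚ)) :
    (c = d ∨ ∀ i, B i 3 = 0) ∧ (A * A = A → B * B = B → X * X = X → Y * Y = Y →
      (X = 0 ∧ A = 0 ∧ B = 0 ∧ Y = 0) ∨ (X = 1 ∧ A = 1 ∧ B = 1 ∧ Y = 1)) := by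
  simp only [← Matrix.ext_iff, Fin.forall_fin_succ, Matrix.mul_apply, Fin.sum_univ_succ] at *
  simp at *
  constructor
  · grind
  · intros
    have h : B 3 3 = 0 ∨ B 3 3 = 1 := by grind
    rcases h with h | h
    · refine .inl ?_
      grind
    · refine .inr ?_
      grind

end FourRepFour

namespace LoopedContour

variable {x y a b : P.Obj} {α : P.Hom a y} {β : P.Hom b y} {γ : P.Hom x a}
  {δ : P.Hom x b} {ω : P.Hom y a} {η : P.Hom b x} (L : LoopedContour α β γ δ ω η)

include L

theorem not_repFin_of_forall_ne (hα : ∀ f : P.Hom a y, ∃ i, f = P.pipow y i ⊚ α)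
    (hβ : ∀ f : P.Hom b y, ∃ i, f = P.pipow y i ⊚ β)
    (hyb : ∀ f : P.Hom y b, β ⊚ f ≠ P.pipow y 1)
    (hab : ∀ f : P.Hom a b, β ⊚ f ≠ P.pipow y 1 ⊚ α) :
    ¬ RepFin P {x, a, b, y} (IdealOf P (P.pipow y 1 ⊚ α ⊚ γ)) := by
  rw [← range_fourPoints]
  refine not_repFin_of_graded L.fourPoints_injective (L.fourTo_gen hα hβ) L.pi_fourTo_ne_zero
    (fun p q => degZero p q) (fun p q => degOne false false p q) L.degZero_of_comp
    (L.degOne_of_comp (fun f h => absurd h (hab f)) (fun f h => absurd h (hyb f))) (fun _ => 4)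
    fourDegZero (fun _ => fourDegOne) ?_ fourDegZero_comp fourDegZero_comp_one
    fourDegOne_comp_zero (fun _ => fourDegOne_comp_one) (s := .src) (t := .tgt)
    (P.pipow y 1 ⊚ α ⊚ γ) (P.id_comp _) (fun _ => rfl) four_pos ?_
  · rintro c (_ | _ | _ | _) <;> rfl
  · intro c d Φ h0 h1
    have h := four_hom (h0 .fst .tgt α (P.id_comp _)) (h0 .snd .tgt β (P.id_comp _))
      (h0 .src .fst γ rfl) (h0 .src .snd δ L.comm.symm)
      (h1 .tgt .fst ω (by rw [fourTo, fourTo, P.comp_id, L.rho]))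
      (h1 .snd .src η L.fourTo_src_comp_η)
    refine ⟨h.1.imp_right fun h => ⟨.snd, 3, h⟩, fun hi => ?_⟩
    refine (h.2 (hi .fst) (hi .snd) (hi .src) (hi .tgt)).imp ?_ ?_ <;>
      rintro ⟨h1, h2, h3, h4⟩ (_ | _ | _ | _)
    exacts [h1, h2, h3, h4, h1, h2, h3, h4]

end LoopedContour

lemma mul_pi_of_isTransit {x y : P.Obj} {mu : P.Hom x y} (h : P.IsTransit mu) :
    ∃ k, mu ⊚ P.pipow x 1 = P.pipow y k ⊚ mu := by
  obtain ⟨h0, g, ⟨i, j, rfl⟩, hg⟩ := h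
  obtain ⟨l, hl⟩ := hg mu ⟨0, 0, by rw [pipow_zero_comp, comp_pipow_zero]⟩
  rw [pipow_comp_pipow_comp] at hl
  obtain ⟨h1, rfl⟩ := eq_zero_of_eq_pipow_comp h0 hl.symm
  obtain rfl : i = 0 := by omega
  rw [comp_pipow_zero, pipow_zero_comp] at hg
  exact hg _ ⟨0, 1, by rw [pipow_zero_comp]⟩

lemma pi_comp_ne_zero_of_not_isDeep {x y : P.Obj} {mu : P.Hom x y} (h : P.IsTransit mu)
    (hd : ¬ P.IsDeep mu) : P.pipow y 1 ⊚ mu ≠ P.zero x y := by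
  intro h1
  refine hd ⟨h.1, h1, ?_⟩
  obtain ⟨k, hk⟩ := mul_pi_of_isTransit h
  cases k with
  | zero =>
    rw [pipow_zero_comp] at hk
    exact absurd (comp_pipow_eq_self h.1 hk) one_ne_zero
  | succ k =>
    rw [pipow_add, P.assoc, h1, P.comp_zero] at hk
    exact hk

lemma mem_projSupp {x y z : P.Obj} {mu : P.Hom x y} (h0 : mu ≠ P.zero x y) {e : P.Hom z y}
    {f : P.Hom x z} (h : e ⊚ f = mu) : z ∈ ProjSupp P (IdealOf P (P.pipow y 1 ⊚ mu)) x := by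
  refine ⟨f, right_ne_zero (h ▸ h0), ?_⟩
  rintro ⟨g, k, hf⟩
  obtain ⟨i, hi⟩ := P.endo_cyclic _ (e ⊚ g)
  obtain ⟨j, rfl⟩ := P.endo_cyclic _ k
  rw [hf, reassoc hi, P.assoc, pipow_comp_pipow_comp] at h
  exact Nat.succ_ne_zero i (eq_zero_of_eq_pipow_comp h0 h).1

lemma _root_.RPath.append_nil {x y : P.Obj} (p : RPath P x y) : p.append (.nil x) = p := by
  induction p with
  | nil => rw [RPath.append]
  | cons f hf p ih => rw [RPath.append, ih]

lemma _root_.RPath.interlaced_cons {x y a : P.Obj} {α : P.Hom a y} (hα : P.IsIrreducible α)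
    {p q : RPath P x a} (h : p.toHom = q.toHom) (h0 : p.toHom ≠ P.zero x a) :
    RPath.Interlaced (.cons α hα p) (.cons α hα q) :=
  .single ⟨x, a, .cons α hα (.nil a), p, q, .nil x, by simp [RPath.append, RPath.append_nil],
    by simp [RPath.append, RPath.append_nil], h, h0, by simp [RPath.length]⟩

/-- Irreducible morphisms between two different points are unique. -/
lemma IsIrreducible.eq_of_ne {x y : P.Obj} {f g : P.Hom x y} (hf : P.IsIrreducible f)
    (hg : P.IsIrreducible g) (h : x ≠ y) : f = g := by
  rcases hf.generates h with h | h <;> obtain ⟨i, hi⟩ := h g <;>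
    rcases hg.2.2 _ _ _ hi with h | h
  · rw [hi, eq_zero_of_isId_pipow h, pipow_zero_comp]
  · exact absurd h hf.2.1
  · exact absurd h hf.2.1
  · rw [hi, eq_zero_of_isId_pipow h, comp_pipow_zero]

lemma not_repFin_or {x y a b : P.Obj} {α : P.Hom a y} {β : P.Hom b y} {γ : P.Hom x a}
    {δ : P.Hom x b} {ω : P.Hom y a} {η : P.Hom b x} (L : LoopedContour α β γ δ ω η) :
    ¬ RepFin P {x, a, y} (IdealOf P (P.pipow y 1 ⊚ α ⊚ γ)) ∨
      ¬ RepFin P {x, b, y} (IdealOf P (P.pipow y 1 ⊚ α ⊚ γ)) ∨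
      ¬ RepFin P {x, a, b, y} (IdealOf P (P.pipow y 1 ⊚ α ⊚ γ)) := by
  by_cases hα : ∀ f : P.Hom a y, ∃ i, f = P.pipow y i ⊚ α
  swap
  · obtain ⟨j, hj⟩ := L.exists_longLoopLeft hα
    exact .inl (L.not_repFin_left hj)
  by_cases hβ : ∀ f : P.Hom b y, ∃ i, f = P.pipow y i ⊚ β
  swap
  · obtain ⟨l, hl⟩ := L.exists_longLoopRight hβ
    exact .inr (.inl (L.not_repFin_right hl))
  refine .inr (.inr ?_)
  by_cases hyb : ∀ f : P.Hom y b, β ⊚ f ≠ P.pipow y 1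
  swap
  · push Not at hyb
    obtain ⟨χ, hχ⟩ := hyb
    exact L.not_repFin_of_factor_snd hα hβ hχ
  by_cases hab : ∀ f : P.Hom a b, β ⊚ f ≠ P.pipow y 1 ⊚ α
  swap
  · push Not at hab
    obtain ⟨f, hf⟩ := hab
    exact L.not_repFin_of_factor_fst hα hβ hyb hf
  exact L.not_repFin_of_forall_ne hα hβ hyb hab

lemma repFin_of_mild {x y : P.Obj} {C : Contour P x y} (hM : C.Mild) {mu : P.Hom x y}
    (hC : C.v.toHom = mu) (h : mu ⊚ P.pipow x 1 = P.pipow y 1 ⊚ mu) {D : Set P.Obj}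
    (hx : x ∈ D) (hy : y ∈ D)
    (hD : D ⊆ ProjSupp P (IdealOf P (P.pipow y 1 ⊚ mu)) x)
    (hf : D.Finite) (hn : D.ncard ≤ 4) : RepFin P D (IdealOf P (P.pipow y 1 ⊚ mu)) := by
  subst hC
  have hI : C.Ic = C.It := by
    unfold Contour.Ic Contour.It RayCategory.pi
    rw [h]
  rcases hM with ⟨-, -, hM⟩ | ⟨-, -, hM⟩
  · exact hM D ⟨hx, hy, hD.trans Set.subset_union_left⟩ hf hn
  · change D ⊆ ProjSupp P C.It x at hD
    change RepFin P D C.It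
    rw [← hI] at hD ⊢
    exact hM D ⟨hx, hy, hD.trans Set.subset_union_left⟩ hf hn

lemma ncard_insert_insert_le {α : Type*} (a b c d : α) :
    ({a, b, c, d} : Set α).ncard ≤ 4 :=
  (Set.ncard_insert_le _ _).trans (Nat.succ_le_succ
    ((Set.ncard_insert_le _ _).trans (Nat.succ_le_succ
      ((Set.ncard_insert_le _ _).trans (Nat.succ_le_succ (Set.ncard_singleton _).le)))))

lemma ncard_insert_le {α : Type*} (a b c : α) : ({a, b, c} : Set α).ncard ≤ 4 := by
  simpa using ncard_insert_insert_le a a b c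
end RayCategory

open RayCategory in
/-- **Lemma 2.6.** Let `C = {v,w}` be a mild contour from `x` to `y` with `v⃗` transit,
`α = v⃗_1`, `β = w⃗_1`, `γ = v⃗_2⋯v⃗_n` and `ρ = π(y) = αω` where `ω` is not an
identity.  If `ωβ = γη` for some non-identity `η`, then `γ = ωξ` for some `ξ` or
`ωα = γφ` for some `φ`. -/
theorem mild_contour_case_II (P : RayCategory) {x y : P.Obj} (C : Contour P x y)
    (hM : C.Mild) (hT : P.IsTransit C.v.toHom)
    {a1 b1 : P.Obj} (alp : P.Hom a1 y) (halp : P.IsIrreducible alp) (p : RPath P x a1)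
    (hv : C.v = RPath.cons alp halp p)
    (bet : P.Hom b1 y) (hbet : P.IsIrreducible bet) (q : RPath P x b1)
    (hw : C.w = RPath.cons bet hbet q)
    (om : P.Hom y a1) (hom : P.pi y = P.comp alp om) (hnid : ¬ P.IsId om)
    (eta : P.Hom b1 x) (hneta : ¬ P.IsId eta)
    (heq : P.comp om bet = P.comp p.toHom eta) :
    (∃ ξ : P.Hom x y, p.toHom = P.comp om ξ) ∨
    (∃ φ : P.Hom a1 x, P.comp om alp = P.comp p.toHom φ) := by
  have hμ : C.v.toHom = P.comp alp p.toHom := by rw [hv, RPath.toHom]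
  have hμ' : P.comp alp p.toHom = P.comp bet q.toHom := by
    rw [← hμ, C.hom_eq, hw, RPath.toHom]
  have h0 := hμ ▸ C.nz
  rw [hμ] at hT
  have hρ : P.pipow y 1 = P.comp alp om := hom
  have hρμ : P.comp (P.pipow y 1) (P.comp alp p.toHom) ≠ P.zero x y := by
    refine pi_comp_ne_zero_of_not_isDeep hT (hμ ▸ ?_)
    rcases hM with hM | hM
    exacts [hM.1, hM.1]
  obtain ⟨k, hk⟩ := mul_pi_of_isTransit hT
  obtain ⟨m, hm⟩ := P.endo_cyclic x (P.comp eta q.toHom)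
  have hηδ : P.comp (P.pipow y 1) (P.comp alp p.toHom) =
      P.comp (P.pipow y (k * m)) (P.comp alp p.toHom) := by
    rw [← comp_pipow_of_comp_pi hk, ← hm, hμ', hρ, P.assoc, reassoc_comp heq, ← P.assoc, hμ']
  obtain ⟨rfl, rfl⟩ : k = 1 ∧ m = 1 :=
    mul_eq_one.1 (pipow_comp_inj hηδ hρμ).symm
  by_contra hcon
  push Not at hcon
  have hay : a1 ≠ y := by
    rintro rfl
    obtain ⟨i, rfl⟩ := P.endo_cyclic _ alp
    obtain ⟨j, rfl⟩ := P.endo_cyclic _ om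
    rw [pipow_comp_pipow] at hρ
    have h1 := pipow_inj hρ (left_ne_zero hρμ)
    obtain rfl | rfl : i = 0 ∨ j = 0 := by omega
    · exact halp.2.1 (isId_iff.2 (P.pipow_zero _))
    · exact hnid (isId_iff.2 (P.pipow_zero _))
  have hab : a1 ≠ b1 := by
    rintro rfl
    obtain rfl := halp.eq_of_ne hbet hay
    refine C.nint ?_
    rw [hv, hw]
    exact RPath.interlaced_cons halp (cancel_left hμ' h0) (right_ne_zero h0)
  have L : LoopedContour alp bet p.toHom q.toHom om eta :=
    ⟨halp, hbet, hμ', hρ, hm.symm, heq, hρμ, hcon.1, hcon.2, hab⟩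
  have hx := mem_projSupp h0 (P.comp_id _)
  have ha := mem_projSupp h0 rfl
  have hb := mem_projSupp h0 hμ'.symm
  have hy := mem_projSupp h0 (P.id_comp _)
  rcases not_repFin_or L with h | h | h <;>
    refine h (repFin_of_mild hM hμ hk (by simp) (by simp) ?_ (Set.toFinite _) ?_)
  · rintro z (rfl | rfl | rfl)
    exacts [hx, ha, hy]
  · exact ncard_insert_le _ _ _
  · rintro z (rfl | rfl | rfl)
    exacts [hx, hb, hy]
  · exact ncard_insert_le _ _ _
  · rintro z (rfl | rfl | rfl | rfl)
    exacts [hx, ha, hb, hy]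
  · exact ncard_insert_insert_le _ _ _ _
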